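/- arXiv:2111.10397 — 9 statements merged into one kernel-verified Lean document; each statement's English description precedes it below -/
import Mathlib

section
/- Let f : ℝ×ℝ → ℂ be continuous, bounded, 2π-periodic in its first variable and even, and let g be continuous and even on 𝕊². Then ∫₀^{2π} ∫₀^{π} Rf(θ,ρ) · conj(g(θ,ρ)) · sin ρ dρ dθ = ∫₀^{2π} ∫_{−∞}^{∞} f(s,t) · conj(R*g(s,t)) dt ds, where both double integrals converge absolutely (the value of Rf at ρ = π/2 is irrelevant since {π/2} has measure zero). -/
open MeasureTheory Real Filter Set Topology ENNReal NNReal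

/-- Parametric Radon transform on the cylinder:
`Rf(θ,ρ) = (1/(2π)) ∫₀^{2π} f(s, −tan ρ · cos(θ−s)) ds`. -/
noncomputable def RT (f : ℝ → ℝ → ℂ) (θ ρ : ℝ) : ℂ :=
  (1 / (2 * π)) * ∫ s in (0:ℝ)..(2 * π), f s (-Real.tan ρ * Real.cos (θ - s))

/-- `n`-th Fourier coefficient of a function on the cylinder (in the angular variable). -/
noncomputable def Fc (f : ℝ → ℝ → ℂ) (n : ℤ) (t : ℝ) : ℂ :=
  (1 / (2 * π)) * ∫ s in (0:ℝ)..(2 * π), f s t * Complex.exp (-Complex.I * n * s)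

/-- `n`-th Fourier coefficient of `Rf` (in the variable θ). -/
noncomputable def Gc (f : ℝ → ℝ → ℂ) (n : ℤ) (ρ : ℝ) : ℂ :=
  (1 / (2 * π)) * ∫ θ in (0:ℝ)..(2 * π), RT f θ ρ * Complex.exp (-Complex.I * n * θ)

/-- `g : ℝ × ℝ → ℂ` (spherical coordinates) is continuous on `𝕊²`, i.e. induced by a
continuous function on (an extension of) the unit sphere of `ℝ³`. -/
def ContOnSphere (g : ℝ → ℝ → ℂ) : Prop :=
  ∃ G : ℝ × ℝ × ℝ → ℂ, Continuous G ∧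
    ∀ θ ρ : ℝ, g θ ρ = G (Real.cos θ * Real.sin ρ, Real.sin θ * Real.sin ρ, Real.cos ρ)

/-- The dual transform `R*g`. -/
noncomputable def RStar (g : ℝ → ℝ → ℂ) (s t : ℝ) : ℂ :=
  (1 / π) *
    ((∫ v in Set.Ioi (0:ℝ),
        g (s + Real.arccos (-t / Real.sqrt (v ^ 2 + t ^ 2)))
            (Real.arctan (Real.sqrt (v ^ 2 + t ^ 2))) *
          (((1 + v ^ 2 + t ^ 2) ^ (-(3:ℝ) / 2) : ℝ) : ℂ)) +
     (∫ v in Set.Ioi (0:ℝ),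
        g (s + (-1) * Real.arccos (-t / Real.sqrt (v ^ 2 + t ^ 2)))
            (Real.arctan (Real.sqrt (v ^ 2 + t ^ 2))) *
          (((1 + v ^ 2 + t ^ 2) ^ (-(3:ℝ) / 2) : ℝ) : ℂ)))

/-- `n`-th Fourier coefficient of a function on the sphere (in the variable θ). -/
noncomputable def Gs (g : ℝ → ℝ → ℂ) (n : ℤ) (ρ : ℝ) : ℂ :=
  (1 / (2 * π)) * ∫ θ in (0:ℝ)..(2 * π), g θ ρ * Complex.exp (-Complex.I * n * θ)

/-- `n`-th Fourier coefficient of `R*g` (in the variable s). -/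
noncomputable def Hc (g : ℝ → ℝ → ℂ) (n : ℤ) (t : ℝ) : ℂ :=
  (1 / (2 * π)) * ∫ s in (0:ℝ)..(2 * π), RStar g s t * Complex.exp (-Complex.I * n * s)

/-- The function on the sphere, restricted to the open upper hemisphere, in the gnomonic chart
rotated by `s`. -/
noncomputable def gnomonic (G : ℝ × ℝ × ℝ → ℂ) (s x y : ℝ) : ℂ :=
  G ((x * Real.cos s - y * Real.sin s) / √(1 + x ^ 2 + y ^ 2),
    (x * Real.sin s + y * Real.cos s) / √(1 + x ^ 2 + y ^ 2), 1 / √(1 + x ^ 2 + y ^ 2))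

theorem continuous_gnomonic {G : ℝ × ℝ × ℝ → ℂ} (hG : Continuous G) :
    Continuous fun q : ℝ × ℝ × ℝ => gnomonic G q.1 q.2.1 q.2.2 := by
  have h : ∀ q : ℝ × ℝ × ℝ, √(1 + q.2.1 ^ 2 + q.2.2 ^ 2) ≠ 0 := fun q => by positivity
  unfold gnomonic
  fun_prop (disch := exact h)

/-- The density of the spherical measure in the gnomonic chart. -/
noncomputable def gnomonicDensity (x y : ℝ) : ℝ := (1 + x ^ 2 + y ^ 2) ^ (-(3 : ℝ) / 2)

theorem gnomonicDensity_nonneg (x y : ℝ) : 0 ≤ gnomonicDensity x y := by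
  unfold gnomonicDensity; positivity

theorem gnomonicDensity_neg_left (x y : ℝ) : gnomonicDensity (-x) y = gnomonicDensity x y := by
  simp [gnomonicDensity]

theorem gnomonicDensity_neg_right (x y : ℝ) : gnomonicDensity x (-y) = gnomonicDensity x y := by
  simp [gnomonicDensity]

theorem continuous_gnomonicDensity :
    Continuous fun q : ℝ × ℝ => gnomonicDensity q.1 q.2 := by
  have h : ∀ q : ℝ × ℝ, 1 + q.1 ^ 2 + q.2 ^ 2 ≠ 0 ∨ 0 ≤ -(3 : ℝ) / 2 :=
    fun q => .inl (by positivity)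
  unfold gnomonicDensity
  exact Continuous.rpow_const (by fun_prop) h

theorem integrable_gnomonicDensity :
    Integrable fun q : ℝ × ℝ => gnomonicDensity q.1 q.2 := by
  have h := integrable_rpow_neg_one_add_norm_sq (E := ℝ × ℝ) (μ := volume) (r := 3)
    (by norm_num)
  refine h.mono' continuous_gnomonicDensity.aestronglyMeasurable (.of_forall fun q => ?_)
  rw [Real.norm_of_nonneg (gnomonicDensity_nonneg _ _)]
  refine Real.rpow_le_rpow_of_nonpos (by positivity) ?_ (by norm_num)
  rw [Prod.norm_def]
  rcases max_choice ‖q.1‖ ‖q.2‖ with h | h <;> rw [h, Real.norm_eq_abs, sq_abs] <;>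
    nlinarith [sq_nonneg q.1, sq_nonneg q.2]

theorem integrable_gnomonicDensity_right (x : ℝ) : Integrable (gnomonicDensity x) := by
  have h := integrable_rpow_neg_one_add_norm_sq (E := ℝ) (μ := volume) (r := 3)
    (by norm_num)
  have hc : Continuous (gnomonicDensity x) :=
    continuous_gnomonicDensity.comp (Continuous.prodMk_right x)
  refine h.mono' hc.aestronglyMeasurable (.of_forall fun y => ?_)
  rw [Real.norm_of_nonneg (gnomonicDensity_nonneg _ _)]
  refine Real.rpow_le_rpow_of_nonpos (by positivity) ?_ (by norm_num)
  rw [Real.norm_eq_abs, sq_abs]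
  nlinarith [sq_nonneg x]

theorem sqrt_one_add_tan_polar {ρ : ℝ} (hρ : ρ ∈ Ioo 0 (π / 2)) (φ : ℝ) :
    √(1 + (Real.tan ρ * Real.cos φ) ^ 2 + (Real.tan ρ * Real.sin φ) ^ 2) = 1 / Real.cos ρ := by
  have hc : 0 < Real.cos ρ := Real.cos_pos_of_mem_Ioo ⟨by linarith [hρ.1, Real.pi_pos], hρ.2⟩
  rw [Real.sqrt_eq_iff_eq_sq (by positivity) (by positivity), Real.tan_eq_sin_div_cos]
  field_simp
  linear_combination (Real.sin ρ ^ 2) * Real.sin_sq_add_cos_sq φ + Real.sin_sq_add_cos_sq ρ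

theorem gnomonicDensity_tan {ρ : ℝ} (hρ : ρ ∈ Ioo 0 (π / 2)) (φ : ℝ) :
    gnomonicDensity (Real.tan ρ * Real.cos φ) (Real.tan ρ * Real.sin φ) = Real.cos ρ ^ 3 := by
  have hc : 0 < Real.cos ρ := Real.cos_pos_of_mem_Ioo ⟨by linarith [hρ.1, Real.pi_pos], hρ.2⟩
  have h := sqrt_one_add_tan_polar hρ φ
  have hp : 0 ≤ 1 + (Real.tan ρ * Real.cos φ) ^ 2 + (Real.tan ρ * Real.sin φ) ^ 2 := by positivity
  rw [gnomonicDensity, show -(3 : ℝ) / 2 = (1 / 2) * (-3 : ℝ) by norm_num, Real.rpow_mul hp,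
    ← Real.sqrt_eq_rpow, h, one_div, Real.inv_rpow hc.le, Real.rpow_neg hc.le, inv_inv]
  exact_mod_cast Real.rpow_natCast (Real.cos ρ) 3

theorem gnomonic_tan {G : ℝ × ℝ × ℝ → ℂ} {g : ℝ → ℝ → ℂ}
    (hgG : ∀ θ ρ : ℝ, g θ ρ = G (Real.cos θ * Real.sin ρ, Real.sin θ * Real.sin ρ, Real.cos ρ))
    {ρ : ℝ} (hρ : ρ ∈ Ioo 0 (π / 2)) (s φ : ℝ) :
    gnomonic G s (Real.tan ρ * Real.cos φ) (Real.tan ρ * Real.sin φ) = g (s + φ) ρ := by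
  have hc : 0 < Real.cos ρ := Real.cos_pos_of_mem_Ioo ⟨by linarith [hρ.1, Real.pi_pos], hρ.2⟩
  rw [gnomonic, hgG, sqrt_one_add_tan_polar hρ φ, Real.tan_eq_sin_div_cos, Real.cos_add,
    Real.sin_add]
  congr 2
  · field_simp
  · congr 1 <;> field_simp

theorem gnomonic_mul_cos_mul_sin {G : ℝ × ℝ × ℝ → ℂ} {g : ℝ → ℝ → ℂ}
    (hgG : ∀ θ ρ : ℝ, g θ ρ = G (Real.cos θ * Real.sin ρ, Real.sin θ * Real.sin ρ, Real.cos ρ))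
    {r : ℝ} (hr : 0 < r) (s φ : ℝ) :
    gnomonic G s (r * Real.cos φ) (r * Real.sin φ) = g (s + φ) (Real.arctan r) := by
  rw [← gnomonic_tan hgG ⟨Real.arctan_pos.2 hr, Real.arctan_lt_pi_div_two r⟩, Real.tan_arctan]

theorem norm_gnomonic_le {G : ℝ × ℝ × ℝ → ℂ} {C : ℝ}
    (hC : ∀ x y z : ℝ, |x| ≤ 1 → |y| ≤ 1 → |z| ≤ 1 → ‖G (x, y, z)‖ ≤ C) (s x y : ℝ) :
    ‖gnomonic G s x y‖ ≤ C := by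
  have hp : 0 < √(1 + x ^ 2 + y ^ 2) := by positivity
  have key : ∀ u : ℝ, u ^ 2 ≤ 1 + x ^ 2 + y ^ 2 → |u / √(1 + x ^ 2 + y ^ 2)| ≤ 1 := by
    intro u hu
    rw [abs_div, abs_of_pos hp, div_le_one hp]
    exact Real.abs_le_sqrt hu
  have h := Real.sin_sq_add_cos_sq s
  apply hC <;> apply key
  · have : (x * Real.cos s - y * Real.sin s) ^ 2 + (x * Real.sin s + y * Real.cos s) ^ 2
        = x ^ 2 + y ^ 2 := by linear_combination (x ^ 2 + y ^ 2) * h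
    nlinarith [sq_nonneg (x * Real.sin s + y * Real.cos s)]
  · have : (x * Real.cos s - y * Real.sin s) ^ 2 + (x * Real.sin s + y * Real.cos s) ^ 2
        = x ^ 2 + y ^ 2 := by linear_combination (x ^ 2 + y ^ 2) * h
    nlinarith [sq_nonneg (x * Real.cos s - y * Real.sin s)]
  · nlinarith [sq_nonneg x, sq_nonneg y]

theorem exists_bound_of_continuous {G : ℝ × ℝ × ℝ → ℂ} (hG : Continuous G) :
    ∃ C : ℝ, ∀ x y z : ℝ, |x| ≤ 1 → |y| ≤ 1 → |z| ≤ 1 → ‖G (x, y, z)‖ ≤ C := by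
  obtain ⟨C, hC⟩ := (isCompact_Icc (a := ((-1 : ℝ), (-1 : ℝ), (-1 : ℝ)))
    (b := ((1 : ℝ), (1 : ℝ), (1 : ℝ)))).exists_bound_of_continuousOn hG.continuousOn
  refine ⟨C, fun x y z hx hy hz => hC _ ?_⟩
  rw [abs_le] at hx hy hz
  exact ⟨⟨hx.1, hy.1, hz.1⟩, ⟨hx.2, hy.2, hz.2⟩⟩

theorem integrable_gnomonic_right {G : ℝ × ℝ × ℝ → ℂ} (hG : Continuous G) (s x : ℝ) :
    Integrable fun v : ℝ => gnomonic G s x v * (gnomonicDensity x v : ℂ) := by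
  obtain ⟨C, hC⟩ := exists_bound_of_continuous hG
  have h1 : Continuous fun v : ℝ => gnomonic G s x v :=
    (continuous_gnomonic hG).comp (by fun_prop : Continuous fun v : ℝ => (s, x, v))
  refine (integrable_gnomonicDensity_right x).ofReal.bdd_mul h1.aestronglyMeasurable
    (.of_forall fun v => norm_gnomonic_le hC s x v)

/-- The dual transform is an integral along a line in the gnomonic chart. -/
theorem RStar_eq_integral_gnomonic {G : ℝ × ℝ × ℝ → ℂ} {g : ℝ → ℝ → ℂ} (hG : Continuous G)
    (hgG : ∀ θ ρ : ℝ, g θ ρ = G (Real.cos θ * Real.sin ρ, Real.sin θ * Real.sin ρ, Real.cos ρ))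
    (s t : ℝ) :
    RStar g s t = (1 / π) * ∫ v : ℝ, gnomonic G s (-t) v * (gnomonicDensity (-t) v : ℂ) := by
  have hI := integrable_gnomonic_right hG s (-t)
  rw [RStar, ← intervalIntegral.integral_Iic_add_Ioi (b := 0) hI.integrableOn hI.integrableOn,
    ← neg_zero (G := ℝ), ← integral_comp_neg_Ioi, neg_zero, add_comm]
  have hpolar : ∀ v : ℝ, 0 < v → 0 < √(v ^ 2 + t ^ 2) ∧
      √(v ^ 2 + t ^ 2) * Real.cos (Real.arccos (-t / √(v ^ 2 + t ^ 2))) = -t ∧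
      √(v ^ 2 + t ^ 2) * Real.sin (Real.arccos (-t / √(v ^ 2 + t ^ 2))) = v := by
    intro v hv
    have hr : 0 < √(v ^ 2 + t ^ 2) := by positivity
    have hsq : √(v ^ 2 + t ^ 2) ^ 2 = v ^ 2 + t ^ 2 := Real.sq_sqrt (by positivity)
    have habs : |-t / √(v ^ 2 + t ^ 2)| ≤ 1 := by
      rw [abs_div, abs_of_pos hr, div_le_one hr]
      exact Real.abs_le_sqrt (by nlinarith)
    rw [abs_le] at habs
    refine ⟨hr, ?_, ?_⟩
    · rw [Real.cos_arccos habs.1 habs.2]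
      field_simp
    · rw [Real.sin_arccos, div_pow, hsq,
        show 1 - (-t) ^ 2 / (v ^ 2 + t ^ 2) = v ^ 2 / (v ^ 2 + t ^ 2) by
          field_simp; ring, Real.sqrt_div (sq_nonneg v), Real.sqrt_sq hv.le]
      field_simp
  congr 2
  · refine setIntegral_congr_fun measurableSet_Ioi fun v hv => ?_
    obtain ⟨hr, hx, hy⟩ := hpolar v hv
    have h := gnomonic_mul_cos_mul_sin hgG hr s (-Real.arccos (-t / √(v ^ 2 + t ^ 2)))
    rw [Real.cos_neg, Real.sin_neg, mul_neg, hx, hy] at h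
    simp only [neg_mul, one_mul]
    rw [← h, gnomonicDensity_neg_left, gnomonicDensity_neg_right, gnomonicDensity]
    ring_nf
  · refine setIntegral_congr_fun measurableSet_Ioi fun v hv => ?_
    obtain ⟨hr, hx, hy⟩ := hpolar v hv
    have h := gnomonic_mul_cos_mul_sin hgG hr s (Real.arccos (-t / √(v ^ 2 + t ^ 2)))
    rw [hx, hy] at h
    rw [← h, gnomonicDensity_neg_left, gnomonicDensity]
    ring_nf

theorem image_tan_Ioo_zero_pi_div_two : Real.tan '' Ioo 0 (π / 2) = Ioi 0 := by
  ext r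
  constructor
  · rintro ⟨ρ, hρ, rfl⟩
    exact Real.tan_pos_of_pos_of_lt_pi_div_two hρ.1 hρ.2
  · intro hr
    exact ⟨Real.arctan r, ⟨Real.arctan_pos.2 hr, Real.arctan_lt_pi_div_two r⟩, Real.tan_arctan r⟩

theorem integral_Ioi_eq_integral_tan (h : ℝ → ℂ) :
    ∫ r in Ioi 0, h r = ∫ ρ in Ioo 0 (π / 2), (1 / Real.cos ρ ^ 2) • h (Real.tan ρ) := by
  have hcos : ∀ ρ ∈ Ioo 0 (π / 2), 0 < Real.cos ρ := fun ρ hρ =>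
    Real.cos_pos_of_mem_Ioo ⟨by linarith [hρ.1, Real.pi_pos], hρ.2⟩
  rw [← image_tan_Ioo_zero_pi_div_two, integral_image_eq_integral_abs_deriv_smul
    (f' := fun ρ => 1 / Real.cos ρ ^ 2) measurableSet_Ioo
    (fun ρ hρ => (Real.hasDerivAt_tan (hcos ρ hρ).ne').hasDerivWithinAt)
    (Real.injOn_tan.mono (Ioo_subset_Ioo_left (by linarith [Real.pi_pos])))]
  refine setIntegral_congr_fun measurableSet_Ioo fun ρ hρ => ?_
  rw [abs_of_nonneg (by positivity)]

theorem integrableOn_polarCoord_symm {Φ : ℝ × ℝ → ℂ} (hΦ : Integrable Φ) :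
    IntegrableOn (fun p : ℝ × ℝ => p.1 • Φ (polarCoord.symm p)) (Ioi 0 ×ˢ Ioo (-π) π) := by
  have h := (integrableOn_image_iff_integrableOn_abs_det_fderiv_smul volume
    (s := polarCoord.target) polarCoord.open_target.measurableSet
    (fun p _ => (hasFDerivAt_polarCoord_symm p).hasFDerivWithinAt) polarCoord.symm.injOn Φ).1
    hΦ.integrableOn
  refine IntegrableOn.congr_fun h (fun p hp => ?_) polarCoord.open_target.measurableSet
  rw [det_fderivPolarCoordSymm, abs_of_pos hp.1]

theorem integral_eq_integral_polar_tan {Φ : ℝ × ℝ → ℂ} (hΦ : Integrable Φ) :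
    ∫ p, Φ p = ∫ φ in Ioo (-π) π, ∫ ρ in Ioo 0 (π / 2),
      (1 / Real.cos ρ ^ 2) • Real.tan ρ • Φ (Real.tan ρ * Real.cos φ, Real.tan ρ * Real.sin φ) := by
  have hI := integrableOn_polarCoord_symm hΦ
  rw [← integral_comp_polarCoord_symm, polarCoord_target]
  rw [IntegrableOn, Measure.volume_eq_prod, ← Measure.prod_restrict] at hI
  rw [Measure.volume_eq_prod, ← Measure.prod_restrict, integral_prod_symm _ hI]
  refine integral_congr_ae (.of_forall fun φ => ?_)
  simp only [polarCoord_symm_apply]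
  rw [integral_Ioi_eq_integral_tan]

theorem integrable_mul_gnomonic {G : ℝ × ℝ × ℝ → ℂ} (hG : Continuous G) {u : ℝ → ℂ}
    (hu : Continuous u) {M : ℝ} (hM : ∀ t, ‖u t‖ ≤ M) (s : ℝ) :
    Integrable fun p : ℝ × ℝ =>
      u (-p.1) * (starRingEnd ℂ) (gnomonic G s p.1 p.2) * (gnomonicDensity p.1 p.2 : ℂ) := by
  obtain ⟨C, hC⟩ := exists_bound_of_continuous hG
  have h1 : Continuous fun p : ℝ × ℝ => gnomonic G s p.1 p.2 :=
    (continuous_gnomonic hG).comp (by fun_prop : Continuous fun p : ℝ × ℝ => (s, p.1, p.2))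
  have h2 : Continuous fun p : ℝ × ℝ => u (-p.1) * (starRingEnd ℂ) (gnomonic G s p.1 p.2) :=
    (hu.comp (by fun_prop)).mul (Complex.continuous_conj.comp h1)
  refine integrable_gnomonicDensity.ofReal.bdd_mul (c := M * C) h2.aestronglyMeasurable
    (.of_forall fun p => ?_)
  rw [norm_mul, RCLike.norm_conj]
  exact mul_le_mul (hM _) (norm_gnomonic_le hC _ _ _) (norm_nonneg _)
    ((norm_nonneg _).trans (hM 0))

/-- The duality relation on a single line `{s} × ℝ` of the cylinder. -/
theorem integral_mul_conj_RStar {G : ℝ × ℝ × ℝ → ℂ} {g : ℝ → ℝ → ℂ} (hG : Continuous G)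
    (hgG : ∀ θ ρ : ℝ, g θ ρ = G (Real.cos θ * Real.sin ρ, Real.sin θ * Real.sin ρ, Real.cos ρ))
    {u : ℝ → ℂ} (hu : Continuous u) {M : ℝ} (hM : ∀ t, ‖u t‖ ≤ M) (s : ℝ) :
    ∫ t : ℝ, u t * (starRingEnd ℂ) (RStar g s t) =
      (1 / π) * ∫ θ in (0:ℝ)..(2 * π), ∫ ρ in Ioo 0 (π / 2),
        u (-Real.tan ρ * Real.cos (θ - s)) * (starRingEnd ℂ) (g θ ρ) *
          ((Real.sin ρ : ℝ) : ℂ) := by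
  have hI := integrable_mul_gnomonic hG hu hM s
  have hplane : ∫ t : ℝ, u t * (starRingEnd ℂ) (RStar g s t) =
      (1 / π) * ∫ p : ℝ × ℝ,
        u (-p.1) * (starRingEnd ℂ) (gnomonic G s p.1 p.2) * (gnomonicDensity p.1 p.2 : ℂ) := by
    rw [Measure.volume_eq_prod, integral_prod _ hI, ← integral_neg_eq_self,
      ← integral_const_mul]
    refine integral_congr_ae (.of_forall fun x => ?_)
    simp only
    rw [RStar_eq_integral_gnomonic hG hgG, neg_neg, map_mul, ← integral_conj]
    simp only [mul_assoc, integral_const_mul, map_mul, Complex.conj_ofReal, map_div₀, map_one]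
    ring
  rw [hplane, integral_eq_integral_polar_tan hI]
  congr 1
  set k : ℝ → ℂ := fun θ => ∫ ρ in Ioo 0 (π / 2),
        u (-Real.tan ρ * Real.cos (θ - s)) * (starRingEnd ℂ) (g θ ρ) *
          ((Real.sin ρ : ℝ) : ℂ) with hk
  have hper : Function.Periodic (fun φ => k (φ + s)) (2 * π) := by
    intro φ
    have : φ + 2 * π + s = φ + s + 2 * π := by ring
    simp only [hk, this]
    refine integral_congr_ae (.of_forall fun ρ => ?_)
    simp only
    rw [show φ + s + 2 * π - s = φ + s - s + 2 * π by ring, Real.cos_add_two_pi, hgG, hgG,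
      Real.cos_add_two_pi, Real.sin_add_two_pi]
  have hshift := hper.intervalIntegral_add_eq (-π) (-s)
  rw [intervalIntegral.integral_comp_add_right, intervalIntegral.integral_comp_add_right,
    show -s + s = 0 by ring, show -s + 2 * π + s = 2 * π by ring,
    ← intervalIntegral.integral_comp_add_right, show -π + 2 * π = π by ring] at hshift
  rw [← hshift, intervalIntegral.integral_of_le (by linarith [Real.pi_pos]),
    integral_Ioc_eq_integral_Ioo]
  refine integral_congr_ae (.of_forall fun φ => ?_)
  refine setIntegral_congr_fun measurableSet_Ioo fun ρ hρ => ?_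
  have hc : 0 < Real.cos ρ := Real.cos_pos_of_mem_Ioo ⟨by linarith [hρ.1, Real.pi_pos], hρ.2⟩
  have hw : 1 / Real.cos ρ ^ 2 * Real.tan ρ * Real.cos ρ ^ 3 = Real.sin ρ := by
    rw [Real.tan_eq_sin_div_cos]; field_simp
  simp only [Complex.real_smul]
  rw [gnomonic_tan hgG hρ, gnomonicDensity_tan hρ, ← hw, add_sub_cancel_right, neg_mul,
    add_comm s φ]
  push_cast
  ring

theorem measurable_RT_integrand {f : ℝ → ℝ → ℂ} (hf : Continuous (Function.uncurry f)) :
    Measurable fun q : (ℝ × ℝ) × ℝ => f q.2 (-Real.tan q.1.2 * Real.cos (q.1.1 - q.2)) := by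
  have htan : Measurable Real.tan := by
    have : Real.tan = fun x => Real.sin x / Real.cos x := funext Real.tan_eq_sin_div_cos
    rw [this]; fun_prop
  exact hf.measurable.comp (by fun_prop : Measurable fun q : (ℝ × ℝ) × ℝ =>
    (q.2, -Real.tan q.1.2 * Real.cos (q.1.1 - q.2)))

theorem stronglyMeasurable_RT {f : ℝ → ℝ → ℂ} (hf : Continuous (Function.uncurry f)) :
    StronglyMeasurable fun p : ℝ × ℝ => RT f p.1 p.2 := by
  have h := (measurable_RT_integrand hf).stronglyMeasurable.integral_prod_right'
    (ν := volume.restrict (Ioc 0 (2 * π)))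
  simp only [RT, intervalIntegral.integral_of_le two_pi_pos.le]
  exact h.const_mul _

theorem norm_RT_le {f : ℝ → ℝ → ℂ} {M : ℝ} (hM : ∀ s t, ‖f s t‖ ≤ M) (θ ρ : ℝ) :
    ‖RT f θ ρ‖ ≤ M := by
  have h := intervalIntegral.norm_integral_le_of_norm_le_const (a := 0) (b := 2 * π)
    (f := fun s => f s (-Real.tan ρ * Real.cos (θ - s))) (C := M) fun s _ => hM _ _
  rw [sub_zero, abs_of_pos two_pi_pos] at h
  rw [RT, norm_mul]
  have h2 : ‖(1 / (2 * π) : ℂ)‖ = 1 / (2 * π) := by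
    rw [norm_div, norm_mul, Complex.norm_real, Real.norm_of_nonneg Real.pi_pos.le]; simp
  rw [h2]
  calc 1 / (2 * π) * _ ≤ 1 / (2 * π) * (M * (2 * π)) := by gcongr
    _ = M := by field_simp

theorem RT_add_two_pi (f : ℝ → ℝ → ℂ) (θ ρ : ℝ) : RT f (θ + 2 * π) ρ = RT f θ ρ := by
  simp only [RT, add_sub_right_comm θ, Real.cos_add_two_pi]

theorem RT_add_pi_pi_sub (f : ℝ → ℝ → ℂ) (θ ρ : ℝ) : RT f (θ + π) (π - ρ) = RT f θ ρ := by
  simp only [RT, add_sub_right_comm θ, Real.cos_add_pi, Real.tan_pi_sub, neg_neg, neg_mul,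
    mul_neg]

/-- The integral over the sphere of an even function is twice that over the upper hemisphere. -/
theorem integral_sphere_eq_two_mul {k : ℝ → ℝ → ℂ} (hk : Measurable (Function.uncurry k))
    {B : ℝ} (hB : ∀ θ ρ, ‖k θ ρ‖ ≤ B) (hper : ∀ θ ρ, k (θ + 2 * π) ρ = k θ ρ)
    (heven : ∀ θ ρ, k (θ + π) (π - ρ) = k θ ρ) :
    ∫ θ in (0:ℝ)..(2 * π), ∫ ρ in (0:ℝ)..π, k θ ρ =
      2 * ∫ θ in (0:ℝ)..(2 * π), ∫ ρ in Ioo 0 (π / 2), k θ ρ := by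
  have hint : ∀ θ a b, IntervalIntegrable (k θ) volume a b := fun θ a b =>
    (intervalIntegrable_const (c := B)).mono_fun'
      (hk.comp measurable_prodMk_left).aestronglyMeasurable (.of_forall fun ρ => hB θ ρ)
  set A : ℝ → ℂ := fun θ => ∫ ρ in (0:ℝ)..(π / 2), k θ ρ with hA
  have hAper : Function.Periodic A (2 * π) := fun θ => by simp only [hA, hper]
  have hAint : ∀ a b, IntervalIntegrable A volume a b := by
    intro a b
    refine (intervalIntegrable_const (c := B * |π / 2 - 0|)).mono_fun' ?_
      (.of_forall fun θ => intervalIntegral.norm_integral_le_of_norm_le_const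
        fun ρ _ => hB θ ρ)
    simp only [hA, intervalIntegral.integral_of_le pi_div_two_pos.le]
    exact (hk.stronglyMeasurable.integral_prod_right'
      (ν := volume.restrict (Ioc 0 (π / 2)))).aestronglyMeasurable
  have hsplit : ∀ θ, ∫ ρ in (0:ℝ)..π, k θ ρ = A θ + A (θ + π) := by
    intro θ
    rw [← intervalIntegral.integral_add_adjacent_intervals (hint θ 0 (π / 2)) (hint θ _ _)]
    congr 1
    have h := intervalIntegral.integral_comp_sub_left (a := 0) (b := π / 2) (k θ) π
    rw [sub_zero, show π - π / 2 = π / 2 by ring] at h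
    rw [← h]
    refine intervalIntegral.integral_congr fun ρ _ => ?_
    rw [← heven (θ + π) ρ, show θ + π + π = θ + 2 * π by ring, hper]
  simp only [hsplit]
  have hshift := hAper.intervalIntegral_add_eq π 0
  have hA2 : IntervalIntegrable (fun θ => A (θ + π)) volume 0 (2 * π) := by
    simpa using (hAint (0 + π) (2 * π + π)).comp_add_right π
  rw [intervalIntegral.integral_add (hAint _ _) hA2,
    intervalIntegral.integral_comp_add_right, zero_add, add_comm (2 * π) π, hshift, zero_add,
    ← two_mul]
  simp only [hA, intervalIntegral.integral_of_le pi_div_two_pos.le, integral_Ioc_eq_integral_Ioo]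

theorem integrableOn_mul_conj_RStar {f g : ℝ → ℝ → ℂ} {G : ℝ × ℝ × ℝ → ℂ}
    (hf : Continuous (Function.uncurry f)) {M : ℝ} (hM : ∀ s t, ‖f s t‖ ≤ M) (hG : Continuous G)
    (hgG : ∀ θ ρ : ℝ, g θ ρ = G (Real.cos θ * Real.sin ρ, Real.sin θ * Real.sin ρ, Real.cos ρ)) :
    IntegrableOn (fun p : ℝ × ℝ => f p.1 p.2 * (starRingEnd ℂ) (RStar g p.1 p.2))
      (Ioc (0:ℝ) (2 * π) ×ˢ univ) := by
  obtain ⟨C, hC⟩ := exists_bound_of_continuous hG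
  have hgn : Continuous fun q : ℝ × ℝ × ℝ => gnomonic G q.1 (-q.2.1) q.2.2 :=
    (continuous_gnomonic hG).comp
      (by fun_prop : Continuous fun q : ℝ × ℝ × ℝ => (q.1, -q.2.1, q.2.2))
  have hc : Continuous fun q : ℝ × ℝ × ℝ =>
      f q.1 q.2.1 * (starRingEnd ℂ) (gnomonic G q.1 (-q.2.1) q.2.2) :=
    (hf.comp (by fun_prop : Continuous fun q : ℝ × ℝ × ℝ => (q.1, q.2.1))).mul
      (Complex.continuous_conj.comp hgn)
  have hw : Integrable (fun q : ℝ × ℝ × ℝ => gnomonicDensity q.2.1 q.2.2)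
      ((volume.restrict (Ioc (0:ℝ) (2 * π))).prod (volume.prod volume)) :=
    integrable_gnomonicDensity.comp_snd _
  have h3 := hw.ofReal (𝕜 := ℂ) |>.bdd_mul (c := M * C) hc.aestronglyMeasurable
    (.of_forall fun q => by
      rw [norm_mul, RCLike.norm_conj]
      exact mul_le_mul (hM _ _) (norm_gnomonic_le hC _ _ _) (norm_nonneg _)
        ((norm_nonneg _).trans (hM 0 0)))
  have h4 := (measurePreserving_prodAssoc (volume.restrict (Ioc (0:ℝ) (2 * π)))
    (volume : Measure ℝ) (volume : Measure ℝ)).integrable_comp_of_integrable h3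
  have h5 := h4.integral_prod_left.const_mul (1 / π : ℂ)
  rw [IntegrableOn, Measure.volume_eq_prod, ← Measure.prod_restrict, Measure.restrict_univ]
  refine h5.congr (.of_forall fun p => ?_)
  simp only [Function.comp, MeasurableEquiv.prodAssoc, MeasurableEquiv.coe_mk,
    Equiv.prodAssoc_apply]
  rw [RStar_eq_integral_gnomonic hG hgG, map_mul, ← integral_conj]
  simp only [mul_assoc, integral_const_mul, map_mul, Complex.conj_ofReal, map_div₀, map_one,
    gnomonicDensity_neg_left, RCLike.ofReal_eq_complex_ofReal]
  ring

/-- duality relation between `R` and its dual `R*`. -/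
theorem statement6 (f : ℝ → ℝ → ℂ) (g : ℝ → ℝ → ℂ)
    (hf_cont : Continuous (Function.uncurry f))
    (hf_bdd : ∃ M : ℝ, ∀ s t : ℝ, ‖f s t‖ ≤ M)
    (hf_per : ∀ s t : ℝ, f (s + 2 * π) t = f s t)
    (hf_even : ∀ s t : ℝ, f (s + π) (-t) = f s t)
    (hg_cont : ContOnSphere g)
    (hg_even : ∀ θ ρ : ℝ, g (θ + π) (π - ρ) = g θ ρ) :
    IntegrableOn
      (fun p : ℝ × ℝ => RT f p.1 p.2 * (starRingEnd ℂ) (g p.1 p.2) * ((Real.sin p.2 : ℝ) : ℂ))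
      (Set.Ioc (0:ℝ) (2 * π) ×ˢ Set.Ioc (0:ℝ) π) ∧
    IntegrableOn (fun p : ℝ × ℝ => f p.1 p.2 * (starRingEnd ℂ) (RStar g p.1 p.2))
      (Set.Ioc (0:ℝ) (2 * π) ×ˢ Set.univ) ∧
    (∫ θ in (0:ℝ)..(2 * π), ∫ ρ in (0:ℝ)..π,
        RT f θ ρ * (starRingEnd ℂ) (g θ ρ) * ((Real.sin ρ : ℝ) : ℂ))
      = ∫ s in (0:ℝ)..(2 * π), ∫ t : ℝ, f s t * (starRingEnd ℂ) (RStar g s t) := by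
  obtain ⟨M, hM⟩ := hf_bdd
  obtain ⟨G, hG, hgG⟩ := hg_cont
  obtain ⟨C, hC⟩ := exists_bound_of_continuous hG
  have hM0 : 0 ≤ M := (norm_nonneg _).trans (hM 0 0)
  have hgC : ∀ θ ρ, ‖g θ ρ‖ ≤ C := by
    intro θ ρ
    rw [hgG]
    refine hC _ _ _ ?_ ?_ (Real.abs_cos_le_one _) <;> rw [abs_mul]
    · exact mul_le_one₀ (Real.abs_cos_le_one _) (abs_nonneg _) (Real.abs_sin_le_one _)
    · exact mul_le_one₀ (Real.abs_sin_le_one _) (abs_nonneg _) (Real.abs_sin_le_one _)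
  have hg_per : ∀ θ ρ, g (θ + 2 * π) ρ = g θ ρ := fun θ ρ => by
    rw [hgG, hgG, Real.cos_add_two_pi, Real.sin_add_two_pi]
  have hgc : Continuous fun p : ℝ × ℝ => g p.1 p.2 := by
    simp only [hgG]; fun_prop
  have hgs : Continuous fun p : ℝ × ℝ =>
      (starRingEnd ℂ) (g p.1 p.2) * ((Real.sin p.2 : ℝ) : ℂ) :=
    (Complex.continuous_conj.comp hgc).mul (by fun_prop)
  have hgsC : ∀ θ ρ, ‖(starRingEnd ℂ) (g θ ρ) * ((Real.sin ρ : ℝ) : ℂ)‖ ≤ C := by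
    intro θ ρ
    rw [norm_mul, RCLike.norm_conj, Complex.norm_real, Real.norm_eq_abs]
    exact (mul_le_of_le_one_right (norm_nonneg _) (Real.abs_sin_le_one _)).trans (hgC θ ρ)
  have hkm : Measurable fun p : ℝ × ℝ =>
      RT f p.1 p.2 * (starRingEnd ℂ) (g p.1 p.2) * ((Real.sin p.2 : ℝ) : ℂ) := by
    simp only [mul_assoc]
    exact (stronglyMeasurable_RT hf_cont).measurable.mul hgs.measurable
  have hkB : ∀ θ ρ,
      ‖RT f θ ρ * (starRingEnd ℂ) (g θ ρ) * ((Real.sin ρ : ℝ) : ℂ)‖ ≤ M * C := by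
    intro θ ρ
    rw [mul_assoc, norm_mul]
    exact mul_le_mul (norm_RT_le hM _ _) (hgsC _ _) (norm_nonneg _) hM0
  refine ⟨?_, integrableOn_mul_conj_RStar hf_cont hM hG hgG, ?_⟩
  · refine Measure.integrableOn_of_bounded (M := M * C) ?_ hkm.aestronglyMeasurable
      (.of_forall fun p => hkB p.1 p.2)
    rw [Measure.volume_eq_prod, Measure.prod_prod, Real.volume_Ioc, Real.volume_Ioc]
    exact ENNReal.mul_ne_top ENNReal.ofReal_ne_top ENNReal.ofReal_ne_top
  rw [integral_sphere_eq_two_mul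
    (k := fun θ ρ => RT f θ ρ * (starRingEnd ℂ) (g θ ρ) * ((Real.sin ρ : ℝ) : ℂ)) hkm hkB
    (fun θ ρ => by simp only [RT_add_two_pi, hg_per])
    (fun θ ρ => by simp only [RT_add_pi_pi_sub, hg_even, Real.sin_pi_sub])]
  have hline : ∀ s, ∫ t : ℝ, f s t * (starRingEnd ℂ) (RStar g s t) = _ := fun s =>
    integral_mul_conj_RStar hG hgG (hf_cont.comp (Continuous.prodMk_right s)) (hM s) s
  simp only [hline]
  rw [intervalIntegral.integral_const_mul]
  simp only [intervalIntegral.integral_of_le two_pi_pos.le]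
  set μ : Measure ℝ := volume.restrict (Ioc 0 (2 * π)) with hμ
  set ν : Measure ℝ := volume.restrict (Ioo 0 (π / 2)) with hν
  have hF : Integrable (fun q : (ℝ × ℝ) × ℝ =>
      f q.2 (-Real.tan q.1.2 * Real.cos (q.1.1 - q.2)) *
        ((starRingEnd ℂ) (g q.1.1 q.1.2) * ((Real.sin q.1.2 : ℝ) : ℂ))) ((μ.prod ν).prod μ) := by
    refine Integrable.of_bound ((measurable_RT_integrand hf_cont).mul
      (hgs.measurable.comp measurable_fst)).aestronglyMeasurable (M * C) (.of_forall fun q => ?_)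
    rw [norm_mul]
    exact mul_le_mul (hM _ _) (hgsC _ _) (norm_nonneg _) hM0
  have hRT : ∀ θ ρ, RT f θ ρ * (starRingEnd ℂ) (g θ ρ) * ((Real.sin ρ : ℝ) : ℂ) =
      (1 / (2 * π)) * ∫ s, f s (-Real.tan ρ * Real.cos (θ - s)) *
        ((starRingEnd ℂ) (g θ ρ) * ((Real.sin ρ : ℝ) : ℂ)) ∂μ := by
    intro θ ρ
    rw [integral_mul_const, RT, intervalIntegral.integral_of_le two_pi_pos.le]
    ring
  have hswap : ∫ θ, ∫ ρ, ∫ s, f s (-Real.tan ρ * Real.cos (θ - s)) *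
        ((starRingEnd ℂ) (g θ ρ) * ((Real.sin ρ : ℝ) : ℂ)) ∂μ ∂ν ∂μ =
      ∫ s, ∫ θ, ∫ ρ, f s (-Real.tan ρ * Real.cos (θ - s)) *
        ((starRingEnd ℂ) (g θ ρ) * ((Real.sin ρ : ℝ) : ℂ)) ∂ν ∂μ ∂μ := by
    rw [← integral_prod (fun p : ℝ × ℝ => ∫ s, f s (-Real.tan p.2 * Real.cos (p.1 - s)) *
        ((starRingEnd ℂ) (g p.1 p.2) * ((Real.sin p.2 : ℝ) : ℂ)) ∂μ) hF.integral_prod_left,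
      integral_integral_swap hF]
    refine integral_congr_ae ?_
    filter_upwards [hF.prod_left_ae] with s hs
    exact integral_prod _ hs
  simp only [hRT, integral_const_mul, hswap]
  simp only [Function.comp_apply, Function.uncurry_apply_pair, mul_assoc]
  field_simp
end

section
/- Let g be continuous and even on 𝕊². Then for every n ∈ ℤ and every t ∈ ℝ, H_n(t) = (−1)^{|n|} · (2/π) · ∫_{|t|}^{∞} G_n(arctan ω) · ω · T_{|n|}(t/ω) / ( (1+ω²)^{3/2} · √(ω²−t²) ) dω. -/
open MeasureTheory Real Filter Set Topology ENNReal NNReal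

namespace ContOnSphere

variable {g : ℝ → ℝ → ℂ}

lemma continuous_uncurry (hg : ContOnSphere g) : Continuous (Function.uncurry g) := by
  obtain ⟨G, hG, h⟩ := hg
  have : Function.uncurry g = fun p : ℝ × ℝ =>
      G (Real.cos p.1 * Real.sin p.2, Real.sin p.1 * Real.sin p.2, Real.cos p.2) := by
    ext p
    exact h p.1 p.2
  rw [this]
  fun_prop

lemma periodic (hg : ContOnSphere g) (ρ : ℝ) : Function.Periodic (fun θ => g θ ρ) (2 * π) := by
  obtain ⟨G, -, h⟩ := hg
  intro θ
  simp only [h, Real.cos_add_two_pi, Real.sin_add_two_pi]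

lemma exists_norm_le (hg : ContOnSphere g) : ∃ C : ℝ, ∀ θ ρ, ‖g θ ρ‖ ≤ C := by
  obtain ⟨G, hG, h⟩ := hg
  have hK : IsCompact (Icc (-1 : ℝ) 1 ×ˢ Icc (-1 : ℝ) 1 ×ˢ Icc (-1 : ℝ) 1) :=
    isCompact_Icc.prod (isCompact_Icc.prod isCompact_Icc)
  obtain ⟨C, hC⟩ := hK.exists_bound_of_continuousOn hG.continuousOn
  refine ⟨C, fun θ ρ => ?_⟩
  rw [h]
  have hmul : ∀ x y : ℝ, |x| ≤ 1 → |y| ≤ 1 → x * y ∈ Icc (-1 : ℝ) 1 := fun x y hx hy =>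
    abs_le.mp (abs_mul x y ▸ mul_le_one₀ hx (abs_nonneg y) hy)
  exact hC _ ⟨hmul _ _ (Real.abs_cos_le_one θ) (Real.abs_sin_le_one ρ),
    hmul _ _ (Real.abs_sin_le_one θ) (Real.abs_sin_le_one ρ),
    abs_le.mp (Real.abs_cos_le_one ρ)⟩

/-- Translating in the angular variable multiplies the `n`-th Fourier coefficient by a phase. -/
lemma integral_shift (hg : ContOnSphere g) (n : ℤ) (a ρ : ℝ) :
    ∫ s in (0:ℝ)..(2 * π), g (s + a) ρ * Complex.exp (-Complex.I * n * s) =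
      2 * π * (Complex.exp (Complex.I * n * a) * Gs g n ρ) := by
  have hper : Function.Periodic
      (fun θ : ℝ => g θ ρ * Complex.exp (-Complex.I * n * θ)) (2 * π) := by
    intro θ
    have h1 := hg.periodic ρ θ
    have h2 : Complex.exp (-Complex.I * n * ((θ + 2 * π : ℝ) : ℂ)) =
        Complex.exp (-Complex.I * n * θ) := by
      rw [Complex.exp_eq_exp_iff_exists_int]
      refine ⟨-n, ?_⟩
      push_cast
      ring
    simp only at h1 ⊢
    rw [h1, h2]
  have h1 : ∀ s : ℝ, g (s + a) ρ * Complex.exp (-Complex.I * n * s) =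
      Complex.exp (Complex.I * n * a) *
        (fun θ : ℝ => g θ ρ * Complex.exp (-Complex.I * n * θ)) (s + a) := by
    intro s
    have : Complex.exp (-Complex.I * n * s) = Complex.exp (Complex.I * n * a) *
        Complex.exp (-Complex.I * n * ((s + a : ℝ) : ℂ)) := by
      rw [← Complex.exp_add]
      congr 1
      push_cast
      ring
    rw [this]
    ring
  simp_rw [h1]
  rw [intervalIntegral.integral_const_mul,
    intervalIntegral.integral_comp_add_right
      (fun θ : ℝ => g θ ρ * Complex.exp (-Complex.I * n * θ)),
    zero_add, add_comm (2 * π) a, hper.intervalIntegral_add_eq a 0, zero_add, Gs]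
  have : (π : ℂ) ≠ 0 := by exact_mod_cast Real.pi_ne_zero
  field_simp

section Fubini

variable {a b w : ℝ → ℝ}

lemma integrable_prod (hg : ContOnSphere g) (n : ℤ) (ha : Measurable a) (hb : Measurable b)
    (hw : IntegrableOn w (Ioi 0)) :
    Integrable (fun p : ℝ × ℝ => g (p.1 + a p.2) (b p.2) * (w p.2 : ℂ) *
        Complex.exp (-Complex.I * n * p.1))
      ((volume.restrict (Ioc 0 (2 * π))).prod (volume.restrict (Ioi 0))) := by
  obtain ⟨C, hC⟩ := hg.exists_norm_le
  have hw' : Integrable (fun p : ℝ × ℝ => (w p.2 : ℂ))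
      ((volume.restrict (Ioc 0 (2 * π))).prod (volume.restrict (Ioi 0))) :=
    Integrable.comp_snd (f := fun v : ℝ => (w v : ℂ)) (Integrable.ofReal hw) _
  have hm : Measurable (fun p : ℝ × ℝ => g (p.1 + a p.2) (b p.2) *
      Complex.exp (-Complex.I * n * p.1)) := by
    have h1 : Measurable (fun p : ℝ × ℝ => Function.uncurry g (p.1 + a p.2, b p.2)) :=
      hg.continuous_uncurry.measurable.comp (by fun_prop)
    exact h1.mul (by fun_prop)
  refine (hw'.bdd_mul (c := C) hm.aestronglyMeasurable
    (Eventually.of_forall fun p => ?_)).congr (Eventually.of_forall fun p => ?_)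
  · have : ‖Complex.exp (-Complex.I * n * p.1)‖ = 1 := by
      rw [Complex.norm_exp]
      simp
    rw [norm_mul, this, mul_one]
    exact hC _ _
  · ring

lemma intervalIntegrable_integral (hg : ContOnSphere g) (n : ℤ) (ha : Measurable a)
    (hb : Measurable b) (hw : IntegrableOn w (Ioi 0)) :
    IntervalIntegrable (fun s : ℝ => (∫ v in Ioi (0:ℝ), g (s + a v) (b v) * (w v : ℂ)) *
      Complex.exp (-Complex.I * n * s)) volume 0 (2 * π) := by
  rw [intervalIntegrable_iff_integrableOn_Ioc_of_le Real.two_pi_pos.le]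
  have := (hg.integrable_prod n ha hb hw).integral_prod_left
  simpa only [IntegrableOn, integral_mul_const] using this

lemma integral_integral_eq (hg : ContOnSphere g) (n : ℤ) (ha : Measurable a)
    (hb : Measurable b) (hw : IntegrableOn w (Ioi 0)) :
    ∫ s in (0:ℝ)..(2 * π), (∫ v in Ioi (0:ℝ), g (s + a v) (b v) * (w v : ℂ)) *
        Complex.exp (-Complex.I * n * s) =
      ∫ v in Ioi (0:ℝ), 2 * π * (Complex.exp (Complex.I * n * a v) * Gs g n (b v)) * (w v : ℂ) := by
  rw [intervalIntegral.integral_of_le Real.two_pi_pos.le]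
  simp_rw [← integral_mul_const]
  rw [integral_integral_swap (hg.integrable_prod n ha hb hw)]
  refine integral_congr_ae (Eventually.of_forall fun v => ?_)
  simp only
  rw [← hg.integral_shift, ← intervalIntegral.integral_of_le Real.two_pi_pos.le,
    ← intervalIntegral.integral_mul_const]
  refine intervalIntegral.integral_congr fun s _ => ?_
  ring

lemma integrableOn_shift (hg : ContOnSphere g) (n : ℤ) (ha : Measurable a)
    (hb : Measurable b) (hw : IntegrableOn w (Ioi 0)) :
    IntegrableOn (fun v : ℝ =>
      2 * π * (Complex.exp (Complex.I * n * a v) * Gs g n (b v)) * (w v : ℂ)) (Ioi 0) := by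
  refine (hg.integrable_prod n ha hb hw).integral_prod_right.congr
    (Eventually.of_forall fun v => ?_)
  simp only
  rw [← hg.integral_shift, ← intervalIntegral.integral_of_le Real.two_pi_pos.le,
    ← intervalIntegral.integral_mul_const]
  refine intervalIntegral.integral_congr fun s _ => ?_
  ring

end Fubini

end ContOnSphere

lemma integrableOn_one_add_sq_add_sq_rpow (t : ℝ) :
    IntegrableOn (fun v : ℝ => (1 + v ^ 2 + t ^ 2) ^ (-(3:ℝ) / 2)) (Ioi 0) := by
  refine (integrable_inv_one_add_sq.mono' (Measurable.aestronglyMeasurable (by fun_prop))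
    (Eventually.of_forall fun v => ?_)).integrableOn
  have h1 : 1 ≤ 1 + v ^ 2 + t ^ 2 := by nlinarith [sq_nonneg v, sq_nonneg t]
  rw [Real.norm_of_nonneg (by positivity)]
  calc (1 + v ^ 2 + t ^ 2) ^ (-(3:ℝ) / 2) ≤ (1 + v ^ 2 + t ^ 2) ^ (-1 : ℝ) :=
        Real.rpow_le_rpow_of_exponent_le h1 (by norm_num)
    _ = (1 + v ^ 2 + t ^ 2)⁻¹ := Real.rpow_neg_one _
    _ ≤ (1 + v ^ 2)⁻¹ := inv_anti₀ (by positivity) (by nlinarith [sq_nonneg t])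

lemma image_sqrt_sq_add_sq_Ioi (t : ℝ) :
    (fun v : ℝ => √(v ^ 2 + t ^ 2)) '' Ioi 0 = Ioi |t| := by
  ext ω
  simp only [mem_image, mem_Ioi]
  constructor
  · rintro ⟨v, hv, rfl⟩
    exact Real.lt_sqrt_of_sq_lt (by rw [sq_abs]; nlinarith)
  · intro h
    have h2 : t ^ 2 < ω ^ 2 := sq_lt_sq.mpr (h.trans_le (le_abs_self ω))
    refine ⟨√(ω ^ 2 - t ^ 2), Real.sqrt_pos.mpr (by linarith), ?_⟩
    rw [Real.sq_sqrt (by linarith), sub_add_cancel,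
      Real.sqrt_sq ((abs_nonneg t).trans h.le)]

/-- The substitution `ω = √(v² + t²)`. -/
lemma integral_Ioi_abs_eq (t : ℝ) (F : ℝ → ℂ) :
    ∫ ω in Ioi |t|, F ω =
      ∫ v in Ioi (0:ℝ), (v / √(v ^ 2 + t ^ 2)) • F (√(v ^ 2 + t ^ 2)) := by
  have hderiv : ∀ v ∈ Ioi (0:ℝ), HasDerivWithinAt (fun v : ℝ => √(v ^ 2 + t ^ 2))
      (v / √(v ^ 2 + t ^ 2)) (Ioi 0) v := by
    intro v hv
    have hv' : 0 < v := hv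
    have h := (((hasDerivAt_pow 2 v).add_const (t ^ 2)).sqrt (by positivity)).hasDerivWithinAt
      (s := Ioi (0:ℝ))
    refine h.congr_deriv ?_
    have : √(v ^ 2 + t ^ 2) ≠ 0 := (Real.sqrt_pos.mpr (by positivity)).ne'
    field_simp
    norm_num
  have hinj : InjOn (fun v : ℝ => √(v ^ 2 + t ^ 2)) (Ioi 0) := by
    intro x hx y hy hxy
    have h := (Real.sqrt_inj (by positivity) (by positivity)).mp hxy
    exact (sq_eq_sq₀ (le_of_lt hx) (le_of_lt hy)).mp (by linarith)
  rw [← image_sqrt_sq_add_sq_Ioi,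
    integral_image_eq_integral_abs_deriv_smul measurableSet_Ioi hderiv hinj]
  refine setIntegral_congr_fun measurableSet_Ioi fun v hv => ?_
  have hv' : 0 < v := hv
  rw [abs_of_nonneg (by positivity)]

/-- Both shifts by `± arccos (-x)` together produce a Chebyshev polynomial. -/
lemma exp_add_exp_neg_arccos (n : ℤ) {x : ℝ} (hx : |x| ≤ 1) :
    Complex.exp (Complex.I * n * (Real.arccos (-x) : ℝ)) +
        Complex.exp (Complex.I * n * (((-1) * Real.arccos (-x) : ℝ) : ℂ)) =
      2 * ((-1) ^ n.natAbs * (((Polynomial.Chebyshev.T ℝ |n|).eval x : ℝ) : ℂ)) := by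
  obtain ⟨h1, h2⟩ := abs_le.mp hx
  have hcos : Real.cos (Real.arccos x) = x := Real.cos_arccos h1 h2
  have hT : (Polynomial.Chebyshev.T ℝ |n|).eval x = Real.cos (n * Real.arccos x) := by
    conv_lhs => rw [← hcos]
    rw [Polynomial.Chebyshev.T_real_cos]
    rcases abs_choice n with h | h <;> rw [h]
    push_cast
    rw [neg_mul, Real.cos_neg]
  have hsign : Real.cos (n * Real.arccos (-x)) =
      (-1) ^ n.natAbs * Real.cos (n * Real.arccos x) := by
    rw [Real.arccos_neg, mul_sub, Real.cos_int_mul_pi_sub]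
    congr 1
    rcases Int.even_or_odd n with h | h
    · rw [h.neg_one_zpow, (Int.natAbs_even.mpr h).neg_one_pow]
    · rw [h.neg_one_zpow, (Int.natAbs_odd.mpr h).neg_one_pow]
  have hs : ((-1 : ℂ) ^ n.natAbs * ((Real.cos (n * Real.arccos x) : ℝ) : ℂ)) =
      ((Real.cos (n * Real.arccos (-x)) : ℝ) : ℂ) := by
    rw [hsign]
    push_cast
    ring
  rw [hT, hs, Complex.ofReal_cos, Complex.two_cos]
  congr 2 <;> push_cast <;> ring

/-- the Fourier coefficients of `R*g` as Chebyshev fractional integrals of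
those of `g`. -/
theorem statement7 (g : ℝ → ℝ → ℂ)
    (hg_cont : ContOnSphere g)
    (hg_even : ∀ θ ρ : ℝ, g (θ + π) (π - ρ) = g θ ρ) :
    ∀ n : ℤ, ∀ t : ℝ,
      Hc g n t = (-1) ^ n.natAbs * ((2 / π : ℝ) : ℂ) *
        ∫ ω in Set.Ioi |t|, Gs g n (Real.arctan ω) *
          ((ω * (Polynomial.Chebyshev.T ℝ |n|).eval (t / ω) /
              (((1 + ω ^ 2) ^ ((3:ℝ) / 2)) * Real.sqrt (ω ^ 2 - t ^ 2)) : ℝ) : ℂ) := by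
  intro n t
  have hpi : (π : ℂ) ≠ 0 := by exact_mod_cast Real.pi_ne_zero
  have hw := integrableOn_one_add_sq_add_sq_rpow t
  have hb : Measurable fun v : ℝ => Real.arctan (√(v ^ 2 + t ^ 2)) := by fun_prop
  have ha : Measurable fun v : ℝ => Real.arccos (-t / √(v ^ 2 + t ^ 2)) :=
    Real.measurable_arccos.comp (by fun_prop)
  have ha' : Measurable fun v : ℝ => (-1) * Real.arccos (-t / √(v ^ 2 + t ^ 2)) :=
    ha.const_mul _
  have hH : Hc g n t = (1 / (2 * π)) * ((1 / π) *
      ∫ v in Ioi (0:ℝ),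
        (2 * π * (Complex.exp (Complex.I * n * (Real.arccos (-t / √(v ^ 2 + t ^ 2)) : ℝ)) *
            Gs g n (Real.arctan (√(v ^ 2 + t ^ 2)))) *
          (((1 + v ^ 2 + t ^ 2) ^ (-(3:ℝ) / 2) : ℝ) : ℂ) +
        2 * π * (Complex.exp (Complex.I * n *
              (((-1) * Real.arccos (-t / √(v ^ 2 + t ^ 2)) : ℝ) : ℂ)) *
            Gs g n (Real.arctan (√(v ^ 2 + t ^ 2)))) *
          (((1 + v ^ 2 + t ^ 2) ^ (-(3:ℝ) / 2) : ℝ) : ℂ))) := by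
    rw [integral_add (hg_cont.integrableOn_shift n ha hb hw)
      (hg_cont.integrableOn_shift n ha' hb hw),
      ← hg_cont.integral_integral_eq n ha hb hw, ← hg_cont.integral_integral_eq n ha' hb hw,
      ← intervalIntegral.integral_add (hg_cont.intervalIntegrable_integral n ha hb hw)
        (hg_cont.intervalIntegrable_integral n ha' hb hw),
      ← intervalIntegral.integral_const_mul, Hc]
    congr 1
    refine intervalIntegral.integral_congr fun s _ => ?_
    simp only [RStar]
    ring
  rw [hH, integral_Ioi_abs_eq, ← integral_const_mul, ← integral_const_mul, ← integral_const_mul]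
  refine setIntegral_congr_fun measurableSet_Ioi fun v hv => ?_
  have hv' : 0 < v := hv
  have hpos : 0 < v ^ 2 + t ^ 2 := by positivity
  set ω := √(v ^ 2 + t ^ 2) with hω
  have hω0 : 0 < ω := Real.sqrt_pos.mpr hpos
  have hω2 : ω ^ 2 = v ^ 2 + t ^ 2 := Real.sq_sqrt hpos.le
  have hx : |t / ω| ≤ 1 := by
    rw [abs_div, abs_of_pos hω0, div_le_one hω0]
    exact Real.abs_le_sqrt (by nlinarith)
  have hE := exp_add_exp_neg_arccos n hx
  rw [← neg_div] at hE
  have hker : v / ω * (ω * (Polynomial.Chebyshev.T ℝ |n|).eval (t / ω) /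
      (((1 + ω ^ 2) ^ ((3:ℝ) / 2)) * √(ω ^ 2 - t ^ 2))) =
      (Polynomial.Chebyshev.T ℝ |n|).eval (t / ω) * (1 + v ^ 2 + t ^ 2) ^ (-(3:ℝ) / 2) := by
    rw [hω2, add_sub_cancel_right, Real.sqrt_sq hv'.le, neg_div, Real.rpow_neg (by positivity),
      ← add_assoc]
    have : (1 + v ^ 2 + t ^ 2) ^ ((3:ℝ) / 2) ≠ 0 := by positivity
    field_simp
  rw [Complex.real_smul, mul_left_comm ((v / ω : ℝ) : ℂ), ← Complex.ofReal_mul, hker,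
    ← add_mul, ← mul_add, ← add_mul, hE]
  push_cast
  field_simp
end

section
/- Let g be continuous and even on 𝕊². If R*g(s,t) = 0 for all s ∈ ℝ and all t ∈ ℝ, then g is identically zero. -/
open MeasureTheory Real Filter Set Topology ENNReal NNReal

open scoped FourierTransform in
/-- Injectivity of the planar Radon transform: a continuous integrable function on the plane
whose integrals along all lines vanish (whenever they exist) is zero. -/
theorem eq_zero_of_line_integrals_eq_zero {f : ℂ → ℂ} (hc : Continuous f) (hi : Integrable f)
    (h : ∀ (a : Circle) (x : ℝ), Integrable (fun y : ℝ => f (a * (x + y * Complex.I))) →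
      ∫ y : ℝ, f (a * (x + y * Complex.I)) = 0) : f = 0 := by
  have hF : 𝓕 f = 0 := by
    ext w
    obtain ⟨a, ha⟩ : ∃ a : Circle, w = a * (‖w‖ : ℂ) := by
      refine ⟨Circle.exp (Complex.arg w), ?_⟩
      rw [Circle.coe_exp, mul_comm, Complex.norm_mul_exp_arg_mul_I]
    have hrot : MeasurePreserving (rotation a) := (rotation a).measurePreserving
    have hemb : MeasurableEmbedding (rotation a) :=
      (rotation a).toHomeomorph.measurableEmbedding
    have hprod := Complex.volume_preserving_equiv_real_prod.symm
    have hsymm : ∀ p : ℝ × ℝ, Complex.measurableEquivRealProd.symm p = p.1 + p.2 * Complex.I :=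
      fun p => Complex.mk_eq_add_mul_I p.1 p.2
    have hinner : ∀ x y : ℝ, inner ℝ ((a : ℂ) * (x + y * Complex.I)) w = ‖w‖ * x := by
      intro x y
      have h1 : inner ℝ (rotation a (x + y * Complex.I)) (rotation a (‖w‖ : ℂ))
          = inner ℝ ((x : ℂ) + y * Complex.I) (‖w‖ : ℂ) := (rotation a).inner_map_map _ _
      rw [rotation_apply, rotation_apply, ← ha] at h1
      rw [h1, Complex.inner]
      simp
    have hi' : Integrable (fun p : ℝ × ℝ => f (a * (p.1 + p.2 * Complex.I))) := by
      have h1 := (hrot.integrable_comp_emb hemb).2 hi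
      have h2 := (hprod.integrable_comp_emb (MeasurableEquiv.measurableEmbedding _)).2 h1
      simpa only [Function.comp_def, hsymm, rotation_apply] using h2
    have he : Integrable (fun p : ℝ × ℝ =>
        𝐞 (-(‖w‖ * p.1)) • f (a * (p.1 + p.2 * Complex.I))) := by
      refine hi'.mono ?_ (.of_forall fun p => by simp)
      exact Continuous.aestronglyMeasurable (by fun_prop)
    rw [Real.fourier_eq, ← hrot.integral_comp hemb,
      ← hprod.integral_comp (MeasurableEquiv.measurableEmbedding _)]
    simp only [hsymm, rotation_apply, hinner]
    rw [Measure.volume_eq_prod] at he hi' ⊢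
    rw [integral_prod _ he]
    refine integral_eq_zero_of_ae ?_
    filter_upwards [hi'.prod_right_ae] with x hx
    simp only [Circle.smul_def, integral_smul, h a x hx, smul_zero, Pi.zero_apply]
  rw [← hc.fourierInv_fourier_eq hi (by rw [hF]; exact integrable_zero _ _ _), hF]
  ext w
  simp [Real.fourierInv_eq]

/-- The function on the plane obtained from `G` by central projection of the upper half-sphere,
with the weight that turns arc integrals into line integrals. -/
noncomputable def gnomonicLift (G : ℝ × ℝ × ℝ → ℂ) (z : ℂ) : ℂ :=
  G (z.re / √(1 + ‖z‖ ^ 2), z.im / √(1 + ‖z‖ ^ 2), 1 / √(1 + ‖z‖ ^ 2)) *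
    (((1 + ‖z‖ ^ 2) ^ (-(3 : ℝ) / 2) : ℝ) : ℂ)

theorem continuous_gnomonicLift {G : ℝ × ℝ × ℝ → ℂ} (hG : Continuous G) :
    Continuous (gnomonicLift G) := by
  have h0 : ∀ z : ℂ, (1 : ℝ) + ‖z‖ ^ 2 ≠ 0 := fun z => by positivity
  have h1 : ∀ z : ℂ, √((1 : ℝ) + ‖z‖ ^ 2) ≠ 0 := fun z => by positivity
  have h2 : Continuous fun z : ℂ => (1 + ‖z‖ ^ 2) ^ (-(3 : ℝ) / 2) :=
    Continuous.rpow_const (by fun_prop) fun z => Or.inl (h0 z)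
  have h3 : Continuous fun z : ℂ => √((1 : ℝ) + ‖z‖ ^ 2) := by fun_prop
  refine (hG.comp (.prodMk ?_ (.prodMk ?_ ?_))).mul (Complex.continuous_ofReal.comp h2)
  · exact Complex.continuous_re.div h3 h1
  · exact Complex.continuous_im.div h3 h1
  · exact continuous_const.div h3 h1

theorem integrable_gnomonicLift {G : ℝ × ℝ × ℝ → ℂ} (hG : Continuous G) :
    Integrable (gnomonicLift G) := by
  obtain ⟨C, hC⟩ := (isCompact_closedBall (0 : ℝ × ℝ × ℝ) 1).exists_bound_of_continuousOn
    hG.continuousOn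
  have hJ : Integrable (fun z : ℂ => ((1 : ℝ) + ‖z‖ ^ 2) ^ (-(3 : ℝ) / 2)) :=
    integrable_rpow_neg_one_add_norm_sq (by rw [Complex.finrank_real_complex]; norm_num)
  refine (hJ.const_mul C).mono' (continuous_gnomonicLift hG).aestronglyMeasurable
    (.of_forall fun z => ?_)
  rw [gnomonicLift, norm_mul, Complex.norm_real, Real.norm_eq_abs,
    abs_of_nonneg (by positivity : (0 : ℝ) ≤ (1 + ‖z‖ ^ 2) ^ (-(3 : ℝ) / 2))]
  refine mul_le_mul_of_nonneg_right (hC _ ?_) (by positivity)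
  have hs : 0 < √(1 + ‖z‖ ^ 2) := by positivity
  have hle : ‖z‖ ≤ √(1 + ‖z‖ ^ 2) := Real.le_sqrt_of_sq_le (by linarith)
  have h1 : 1 ≤ √(1 + ‖z‖ ^ 2) := Real.le_sqrt_of_sq_le (by nlinarith [sq_nonneg ‖z‖])
  simp only [mem_closedBall_zero_iff, Prod.norm_def, Real.norm_eq_abs, abs_div, abs_of_pos hs,
    abs_one, sup_le_iff, div_le_one hs]
  exact ⟨(Complex.abs_re_le_norm z).trans hle, (Complex.abs_im_le_norm z).trans hle, h1⟩

theorem gnomonicLift_polar {g : ℝ → ℝ → ℂ} {G : ℝ × ℝ × ℝ → ℂ}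
    (hgG : ∀ θ ρ : ℝ, g θ ρ = G (cos θ * sin ρ, sin θ * sin ρ, cos ρ)) (r θ : ℝ) :
    gnomonicLift G (r * Circle.exp θ) =
      g θ (arctan r) * (((1 + r ^ 2) ^ (-(3 : ℝ) / 2) : ℝ) : ℂ) := by
  have hn : ‖(r : ℂ) * Circle.exp θ‖ ^ 2 = r ^ 2 := by simp
  have hre : ((r : ℂ) * Circle.exp θ).re = r * cos θ := by
    rw [Circle.coe_exp, Complex.re_ofReal_mul, Complex.exp_ofReal_mul_I_re]
  have him : ((r : ℂ) * Circle.exp θ).im = r * sin θ := by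
    rw [Circle.coe_exp, Complex.im_ofReal_mul, Complex.exp_ofReal_mul_I_im]
  rw [gnomonicLift, hn, hre, him, hgG, sin_arctan, cos_arctan]
  congr 4 <;> ring_nf

/-- Polar form of a point of the upper half-plane. -/
theorem sqrt_mul_exp_arccos (x v : ℝ) (hv : 0 < v) :
    (√(v ^ 2 + x ^ 2) : ℂ) * Complex.exp (arccos (x / √(v ^ 2 + x ^ 2)) * Complex.I)
      = x + v * Complex.I := by
  have hr : 0 < √(v ^ 2 + x ^ 2) := by positivity
  have hr2 : √(v ^ 2 + x ^ 2) ^ 2 = v ^ 2 + x ^ 2 := Real.sq_sqrt (by positivity)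
  have hsin : sin (arccos (x / √(v ^ 2 + x ^ 2))) = v / √(v ^ 2 + x ^ 2) := by
    rw [sin_arccos, Real.sqrt_eq_iff_eq_sq _ (by positivity), div_pow, div_pow, hr2]
    · field_simp; ring
    · rw [div_pow, hr2, sub_nonneg, div_le_one (by positivity)]
      nlinarith [sq_nonneg v]
  have habs : |x| ≤ √(v ^ 2 + x ^ 2) := Real.abs_le_sqrt (by nlinarith [sq_nonneg v])
  have hcos : cos (arccos (x / √(v ^ 2 + x ^ 2))) = x / √(v ^ 2 + x ^ 2) :=
    cos_arccos (by rw [le_div_iff₀ hr]; linarith [neg_abs_le x])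
      (by rw [div_le_one hr]; exact (le_abs_self x).trans habs)
  apply Complex.ext
  · rw [Complex.re_ofReal_mul, Complex.exp_ofReal_mul_I_re, hcos, mul_div_cancel₀ _ hr.ne']
    simp
  · rw [Complex.im_ofReal_mul, Complex.exp_ofReal_mul_I_im, hsin, mul_div_cancel₀ _ hr.ne']
    simp

/-- `R*g` is the Radon transform of the gnomonic lift of `g`. -/
theorem RStar_eq_line_integral {g : ℝ → ℝ → ℂ} {G : ℝ × ℝ × ℝ → ℂ}
    (hgG : ∀ θ ρ : ℝ, g θ ρ = G (cos θ * sin ρ, sin θ * sin ρ, cos ρ)) (s x : ℝ)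
    (hi : Integrable fun y : ℝ => gnomonicLift G (Circle.exp s * (x + y * Complex.I))) :
    RStar g s (-x) =
      (1 / π) * ∫ y : ℝ, gnomonicLift G (Circle.exp s * (x + y * Complex.I)) := by
  have hsq : ∀ v : ℝ, √(v ^ 2 + x ^ 2) ^ 2 = v ^ 2 + x ^ 2 :=
    fun v => Real.sq_sqrt (by positivity)
  rw [RStar, ← intervalIntegral.integral_Iic_add_Ioi (b := 0) hi.integrableOn hi.integrableOn,
    add_comm (∫ y in Iic (0 : ℝ), _), ← neg_zero, ← integral_comp_neg_Ioi, neg_zero]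
  congr 2
  · refine setIntegral_congr_fun measurableSet_Ioi fun v hv => ?_
    simp only [neg_sq, neg_neg, add_assoc]
    have hp := gnomonicLift_polar hgG √(v ^ 2 + x ^ 2) (s + arccos (x / √(v ^ 2 + x ^ 2)))
    rw [hsq] at hp
    rw [← hp, ← sqrt_mul_exp_arccos x v hv, Circle.exp_add,
      Circle.coe_mul, Circle.coe_exp (arccos _)]
    ring_nf
  · refine setIntegral_congr_fun measurableSet_Ioi fun v hv => ?_
    have hconj := congrArg (starRingEnd ℂ) (sqrt_mul_exp_arccos x v hv)
    simp only [map_mul, map_add, Complex.conj_ofReal, Complex.conj_I, ← Complex.exp_conj] at hconj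
    simp only [neg_sq, neg_neg, add_assoc, neg_one_mul]
    have hpt : (x : ℂ) + ((-v : ℝ) : ℂ) * Complex.I = x + v * -Complex.I := by
      push_cast; ring
    have hp := gnomonicLift_polar hgG √(v ^ 2 + x ^ 2) (s + -arccos (x / √(v ^ 2 + x ^ 2)))
    rw [hsq] at hp
    rw [← hp, hpt, ← hconj, Circle.exp_add,
      Circle.coe_mul, Circle.coe_exp (-arccos _)]
    push_cast
    ring_nf

/-- `R*` is injective on continuous even functions on the sphere. -/
theorem statement8 (g : ℝ → ℝ → ℂ)
    (hg_cont : ContOnSphere g)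
    (hg_even : ∀ θ ρ : ℝ, g (θ + π) (π - ρ) = g θ ρ)
    (hzero : ∀ s t : ℝ, RStar g s t = 0) :
    ∀ θ ρ : ℝ, g θ ρ = 0 := by
  obtain ⟨G, hG, hgG⟩ := hg_cont
  have hlift : gnomonicLift G = 0 := by
    refine eq_zero_of_line_integrals_eq_zero (continuous_gnomonicLift hG)
      (integrable_gnomonicLift hG) fun a x hi => ?_
    obtain ⟨s, rfl⟩ := Circle.exp_surjective a
    have h := RStar_eq_line_integral hgG s x hi
    rw [hzero, eq_comm, mul_eq_zero] at h
    exact h.resolve_left (by simp [Real.pi_ne_zero])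
  have hupper : ∀ θ ρ : ℝ, 0 < cos ρ → g θ ρ = 0 := by
    intro θ ρ hρ
    have h := congrFun hlift (tan ρ * Circle.exp θ)
    rw [gnomonicLift_polar hgG, Pi.zero_apply, mul_eq_zero] at h
    have hpos : (0 : ℝ) < (1 + tan ρ ^ 2) ^ (-(3 : ℝ) / 2) := by positivity
    have h0 := h.resolve_right (Complex.ofReal_ne_zero.2 hpos.ne')
    have hs : √(1 + tan ρ ^ 2) = 1 / cos ρ := by
      rw [← Real.inv_sqrt_one_add_tan_sq hρ]; simp
    rw [hgG, sin_arctan, cos_arctan, hs, tan_eq_sin_div_cos] at h0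
    rw [hgG, ← h0]
    congr 4 <;> field_simp
  have hne : ∀ θ ρ : ℝ, cos ρ ≠ 0 → g θ ρ = 0 := by
    intro θ ρ hρ
    rcases lt_or_gt_of_ne hρ with h | h
    · rw [← hg_even]
      exact hupper _ _ (by rw [cos_pi_sub]; linarith)
    · exact hupper θ ρ h
  intro θ
  have hcount : {ρ : ℝ | cos ρ = 0}.Countable :=
    (countable_range fun k : ℤ => (2 * k + 1 : ℝ) * π / 2).mono fun ρ hρ => by
      obtain ⟨k, hk⟩ := Real.cos_eq_zero_iff.1 hρ
      exact ⟨k, hk.symm⟩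
  have hcont : Continuous (g θ) := by
    rw [funext (hgG θ)]
    fun_prop
  exact congrFun (hcont.ext_on (hcount.dense_compl ℝ) continuous_const fun ρ hρ => hne θ ρ hρ)
end

section
/- Let g be continuous and even on 𝕊². Then for almost every t > 0, G_0(arctan t) = −(1+t²)^{3/2} · (d/dt)[ t · ∫_t^{∞} H_0(r) / ( r · √(r²−t²) ) dr ]. -/
open MeasureTheory Real Filter Set Topology ENNReal NNReal

lemma integral_Ioi_sqrt_add_sq (k : ℝ → ℂ) {τ : ℝ} (hτ : 0 < τ) :
    ∫ r in Ioi τ, k r =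
      ∫ w in Ioi (0:ℝ), (w / √(τ ^ 2 + w ^ 2)) • k (√(τ ^ 2 + w ^ 2)) := by
  have himg : Set.image (fun w : ℝ => √(τ ^ 2 + w ^ 2)) (Ioi 0) = Ioi τ := by
    ext r
    simp only [mem_image, mem_Ioi]
    constructor
    · rintro ⟨w, hw, rfl⟩
      exact Real.lt_sqrt_of_sq_lt (by nlinarith)
    · intro hr
      refine ⟨√(r ^ 2 - τ ^ 2), Real.sqrt_pos.2 (by nlinarith), ?_⟩
      rw [Real.sq_sqrt (by nlinarith), add_sub_cancel, Real.sqrt_sq (by linarith)]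
  have hder : ∀ w ∈ Ioi (0:ℝ), HasDerivWithinAt (fun w : ℝ => √(τ ^ 2 + w ^ 2))
      (w / √(τ ^ 2 + w ^ 2)) (Ioi 0) w := by
    intro w _
    have h := ((hasDerivAt_pow 2 w).const_add (τ ^ 2)).sqrt (by positivity)
    refine (h.congr_deriv ?_).hasDerivWithinAt
    have : √(τ ^ 2 + w ^ 2) ≠ 0 := (Real.sqrt_pos.2 (by positivity)).ne'
    field_simp
    norm_num
  have hinj : InjOn (fun w : ℝ => √(τ ^ 2 + w ^ 2)) (Ioi 0) := by
    intro a ha b hb hab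
    simp only [mem_Ioi] at ha hb
    have := (Real.sqrt_inj (by positivity) (by positivity)).1 hab
    nlinarith
  rw [← himg, integral_image_eq_integral_abs_deriv_smul measurableSet_Ioi hder hinj]
  refine setIntegral_congr_fun measurableSet_Ioi fun w hw => ?_
  simp only [mem_Ioi] at hw
  rw [abs_of_nonneg (by positivity)]

lemma integral_Ioi_inv_sq_mul_one_add_sq_add_sq {τ : ℝ} (hτ : 0 < τ) (y : ℝ) :
    ∫ u in Ioi (0:ℝ), (τ ^ 2 * (1 + u ^ 2) + y ^ 2)⁻¹ = π / (2 * τ * √(τ ^ 2 + y ^ 2)) := by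
  set c := √(τ ^ 2 + y ^ 2) with hc
  have hc0 : 0 < c := Real.sqrt_pos.2 (by positivity)
  have hc2 : c ^ 2 = τ ^ 2 + y ^ 2 := Real.sq_sqrt (by positivity)
  have h := integral_comp_mul_left_Ioi (fun x : ℝ => (1 + x ^ 2)⁻¹) 0 (div_pos hτ hc0)
  rw [mul_zero, integral_Ioi_inv_one_add_sq, arctan_zero, sub_zero] at h
  have e : ∀ u : ℝ, (τ ^ 2 * (1 + u ^ 2) + y ^ 2)⁻¹ = (c ^ 2)⁻¹ * (1 + (τ / c * u) ^ 2)⁻¹ := by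
    intro u
    rw [← mul_inv]
    congr 1
    field_simp
    rw [hc2]
    ring
  simp_rw [e]
  rw [integral_const_mul, h]
  simp only [smul_eq_mul]
  field_simp

/-- Iterated Abel-type transforms reduce to a tail integral. -/
lemma integral_Ioi_integral_Ioi_sqrt {f : ℝ → ℂ} (hf : Continuous f) {C : ℝ}
    (hb : ∀ x, ‖f x‖ * |x| ≤ C * (1 + x ^ 2)⁻¹) {τ : ℝ} (hτ : 0 < τ) :
    ∫ w in Ioi (0:ℝ), (τ ^ 2 + w ^ 2)⁻¹ • ∫ v in Ioi (0:ℝ), f (√(v ^ 2 + (τ ^ 2 + w ^ 2))) =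
      (π / (2 * τ)) • ∫ x in Ioi τ, f x := by
  set μ := (volume : Measure ℝ).restrict (Ioi 0) with hμ
  set K : ℝ → ℝ → ℂ := fun u y => (y * (τ ^ 2 * (1 + u ^ 2) + y ^ 2)⁻¹) • f (√(τ ^ 2 + y ^ 2))
    with hK
  set F : ℝ → ℝ → ℂ :=
    fun u w => (w * (τ ^ 2 + w ^ 2)⁻¹) • f (√((w * u) ^ 2 + (τ ^ 2 + w ^ 2))) with hF
  have hC : 0 ≤ C := by simpa using hb 0
  have hinv : ∀ u y : ℝ, τ ^ 2 * (1 + u ^ 2) + y ^ 2 ≠ 0 := fun u y => by positivity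
  have hinv' : ∀ w : ℝ, τ ^ 2 + w ^ 2 ≠ 0 := fun w => by positivity
  have hKcont : Continuous (Function.uncurry K) := by
    simp only [hK, Function.uncurry_def]
    refine Continuous.smul (.mul (by fun_prop) (.inv₀ (by fun_prop) fun p => hinv _ _)) (by fun_prop)
  have hFcont : Continuous (Function.uncurry F) := by
    simp only [hF, Function.uncurry_def]
    refine Continuous.smul (.mul (by fun_prop) (.inv₀ (by fun_prop) fun p => hinv' _)) (by fun_prop)
  have hKint : Integrable (Function.uncurry K) (μ.prod μ) := by
    have h1 : Integrable (fun x : ℝ => (1 + x ^ 2)⁻¹) μ := integrable_inv_one_add_sq.restrict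
    refine ((h1.mul_prod h1).const_mul (C * (τ ^ 2)⁻¹)).mono' hKcont.aestronglyMeasurable
      (.of_forall fun p => ?_)
    obtain ⟨u, y⟩ := p
    simp only [Function.uncurry, hK, norm_smul, norm_mul, norm_inv, Real.norm_eq_abs]
    rw [abs_of_pos (by positivity : 0 < τ ^ 2 * (1 + u ^ 2) + y ^ 2)]
    have hx : (√(τ ^ 2 + y ^ 2)) ^ 2 = τ ^ 2 + y ^ 2 := Real.sq_sqrt (by positivity)
    have hy : |y| ≤ |√(τ ^ 2 + y ^ 2)| := by
      apply sq_le_sq.1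
      rw [hx]; nlinarith
    have h2 := hb (√(τ ^ 2 + y ^ 2))
    rw [hx] at h2
    calc |y| * (τ ^ 2 * (1 + u ^ 2) + y ^ 2)⁻¹ * ‖f (√(τ ^ 2 + y ^ 2))‖
        = (τ ^ 2 * (1 + u ^ 2) + y ^ 2)⁻¹ * (‖f (√(τ ^ 2 + y ^ 2))‖ * |y|) := by ring
      _ ≤ (τ ^ 2 * (1 + u ^ 2))⁻¹ * (C * (1 + y ^ 2)⁻¹) := by
          refine mul_le_mul (inv_anti₀ (by positivity) (by nlinarith)) ?_ (by positivity)
            (by positivity)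
          refine (mul_le_mul_of_nonneg_left hy (norm_nonneg _)).trans (h2.trans ?_)
          exact mul_le_mul_of_nonneg_left (inv_anti₀ (by positivity) (by nlinarith)) hC
      _ = _ := by rw [mul_inv]; ring
  have hscale : ∀ u w : ℝ, F u w = (√(1 + u ^ 2)) • K u (√(1 + u ^ 2) * w) := by
    intro u w
    have hc0 : 0 < √(1 + u ^ 2) := Real.sqrt_pos.2 (by positivity)
    have hc2 : (√(1 + u ^ 2)) ^ 2 = 1 + u ^ 2 := Real.sq_sqrt (by positivity)
    simp only [hF, hK, smul_smul, mul_pow, hc2]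
    congr 1
    · have h3 : τ ^ 2 * (1 + u ^ 2) + (1 + u ^ 2) * w ^ 2 = (1 + u ^ 2) * (τ ^ 2 + w ^ 2) := by ring
      have := hinv' w
      rw [h3]
      field_simp
      rw [hc2]
    · congr 2; ring
  have hFK : ∀ u, ∫ w, F u w ∂μ = ∫ y, K u y ∂μ := by
    intro u
    have hc0 : 0 < √(1 + u ^ 2) := Real.sqrt_pos.2 (by positivity)
    simp_rw [hscale]
    rw [integral_smul, hμ, integral_comp_mul_left_Ioi (K u) 0 hc0, mul_zero, smul_smul,
      mul_inv_cancel₀ hc0.ne', one_smul]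
  have hFKn : ∀ u, ∫ w, ‖F u w‖ ∂μ = ∫ y, ‖K u y‖ ∂μ := by
    intro u
    have hc0 : 0 < √(1 + u ^ 2) := Real.sqrt_pos.2 (by positivity)
    simp_rw [hscale, norm_smul]
    rw [integral_const_mul, hμ, integral_comp_mul_left_Ioi (fun y => ‖K u y‖) 0 hc0, mul_zero,
      smul_eq_mul, ← mul_assoc, Real.norm_of_nonneg hc0.le, mul_inv_cancel₀ hc0.ne', one_mul]
  have hFint : Integrable (Function.uncurry F) (μ.prod μ) := by
    rw [integrable_prod_iff hFcont.aestronglyMeasurable]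
    have hK' := (integrable_prod_iff hKcont.aestronglyMeasurable).1 hKint
    refine ⟨?_, ?_⟩
    · filter_upwards [hK'.1] with u hu
      have hc0 : 0 < √(1 + u ^ 2) := Real.sqrt_pos.2 (by positivity)
      simp only [Function.uncurry] at hu ⊢
      simp_rw [hscale]
      exact Integrable.smul (√(1 + u ^ 2))
        ((integrableOn_Ioi_comp_mul_left_iff (K u) 0 hc0).2 (by rwa [mul_zero]))
    · simp only [Function.uncurry]
      simp_rw [hFKn]
      exact hK'.2
  calc ∫ w, (τ ^ 2 + w ^ 2)⁻¹ • ∫ v, f (√(v ^ 2 + (τ ^ 2 + w ^ 2))) ∂μ ∂μ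
      = ∫ w, ∫ u, F u w ∂μ ∂μ := by
        refine setIntegral_congr_fun measurableSet_Ioi fun w hw => ?_
        simp only [mem_Ioi] at hw
        have := integral_comp_mul_left_Ioi (fun v => f (√(v ^ 2 + (τ ^ 2 + w ^ 2)))) 0 hw
        simp only [mul_zero] at this
        simp only [hF]
        rw [integral_smul, hμ, this, smul_smul, mul_right_comm, mul_inv_cancel₀ hw.ne', one_mul]
    _ = ∫ u, ∫ w, F u w ∂μ ∂μ := (integral_integral_swap hFint).symm
    _ = ∫ u, ∫ y, K u y ∂μ ∂μ := by simp_rw [hFK]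
    _ = ∫ y, ∫ u, K u y ∂μ ∂μ := integral_integral_swap hKint
    _ = ∫ y, (π / (2 * τ)) • (y / √(τ ^ 2 + y ^ 2)) • f (√(τ ^ 2 + y ^ 2)) ∂μ := by
        congr 1
        ext1 y
        simp only [hK]
        rw [integral_smul_const, integral_const_mul, hμ,
          integral_Ioi_inv_sq_mul_one_add_sq_add_sq hτ, smul_smul]
        congr 1
        ring
    _ = (π / (2 * τ)) • ∫ x in Ioi τ, f x := by
        rw [integral_smul, hμ, ← integral_Ioi_sqrt_add_sq f hτ]

lemma ContOnSphere.continuous_uncurry_s10 {g : ℝ → ℝ → ℂ} (hg : ContOnSphere g) :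
    Continuous (Function.uncurry g) := by
  obtain ⟨G, hG, h⟩ := hg
  have e : Function.uncurry g = fun p : ℝ × ℝ =>
      G (Real.cos p.1 * Real.sin p.2, Real.sin p.1 * Real.sin p.2, Real.cos p.2) := by
    ext p; exact h p.1 p.2
  rw [e]
  fun_prop

lemma ContOnSphere.periodic_s10 {g : ℝ → ℝ → ℂ} (hg : ContOnSphere g) (ρ : ℝ) :
    Function.Periodic (fun θ => g θ ρ) (2 * π) := by
  obtain ⟨G, -, h⟩ := hg
  intro θ
  simp [h]

lemma ContOnSphere.exists_norm_le_s10 {g : ℝ → ℝ → ℂ} (hg : ContOnSphere g) :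
    ∃ C, ∀ θ ρ, ‖g θ ρ‖ ≤ C := by
  obtain ⟨G, hG, h⟩ := hg
  obtain ⟨C, hC⟩ := ((isCompact_Icc (a := (-1 : ℝ)) (b := 1)).prod
    ((isCompact_Icc (a := (-1 : ℝ)) (b := 1)).prod
      (isCompact_Icc (a := (-1 : ℝ)) (b := 1)))).exists_bound_of_continuousOn hG.continuousOn
  refine ⟨C, fun θ ρ => ?_⟩
  rw [h]
  have hmul : ∀ {a b : ℝ}, |a| ≤ 1 → |b| ≤ 1 → |a * b| ≤ 1 := fun {a b} ha hb => by
    rw [abs_mul]; exact mul_le_one₀ ha (abs_nonneg _) hb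
  exact hC _ ⟨abs_le.1 (hmul (abs_cos_le_one θ) (abs_sin_le_one ρ)),
    abs_le.1 (hmul (abs_sin_le_one θ) (abs_sin_le_one ρ)), abs_le.1 (abs_cos_le_one ρ)⟩

lemma Gs_zero (g : ℝ → ℝ → ℂ) (ρ : ℝ) :
    Gs g 0 ρ = (1 / (2 * π)) * ∫ θ in (0:ℝ)..(2 * π), g θ ρ := by
  simp [Gs]

lemma ContOnSphere.continuous_Gs_zero {g : ℝ → ℝ → ℂ} (hg : ContOnSphere g) :
    Continuous (Gs g 0) := by
  have e : Gs g 0 = fun ρ => (1 / (2 * π)) * ∫ θ in (0:ℝ)..(2 * π), g θ ρ :=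
    funext (Gs_zero g)
  rw [e]
  refine continuous_const.mul ?_
  refine intervalIntegral.continuous_parametric_intervalIntegral_of_continuous' ?_ _ _
  exact hg.continuous_uncurry_s10.comp continuous_swap

lemma norm_Gs_zero_le {g : ℝ → ℝ → ℂ} {C : ℝ} (hC : ∀ θ ρ, ‖g θ ρ‖ ≤ C) (ρ : ℝ) :
    ‖Gs g 0 ρ‖ ≤ C := by
  rw [Gs_zero, norm_mul]
  have h := intervalIntegral.norm_integral_le_of_norm_le_const
    (a := 0) (b := 2 * π) (f := fun θ => g θ ρ) (C := C) fun θ _ => hC θ ρ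
  rw [sub_zero, abs_of_pos two_pi_pos] at h
  have h1 : ‖(1 / (2 * π) : ℂ)‖ = 1 / (2 * π) := by
    simp [abs_of_pos pi_pos]
  rw [h1, one_div, inv_mul_le_iff₀ two_pi_pos]
  linarith

/-- Averaging over one period removes an inner translation. -/
lemma integral_integral_translate {g : ℝ → ℝ → ℂ} (hg : ContOnSphere g) {a ρ m : ℝ → ℝ}
    (ha : Measurable a) (hρ : Measurable ρ) (hm : IntegrableOn m (Ioi 0)) :
    IntervalIntegrable (fun s => ∫ v in Ioi (0:ℝ), g (s + a v) (ρ v) * (m v : ℂ))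
      volume 0 (2 * π) ∧
    ∫ s in (0:ℝ)..(2 * π), ∫ v in Ioi (0:ℝ), g (s + a v) (ρ v) * (m v : ℂ) =
      2 * π * ∫ v in Ioi (0:ℝ), Gs g 0 (ρ v) * (m v : ℂ) := by
  obtain ⟨C, hC⟩ := hg.exists_norm_le_s10
  have hC0 : 0 ≤ C := (norm_nonneg _).trans (hC 0 0)
  have hint : Integrable (Function.uncurry fun s v => g (s + a v) (ρ v) * (m v : ℂ))
      ((volume.restrict (Ioc 0 (2 * π))).prod (volume.restrict (Ioi 0))) := by
    have h1 : Integrable (fun _ : ℝ => C) (volume.restrict (Ioc 0 (2 * π))) :=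
      integrable_const C
    refine (h1.mul_prod hm.norm).mono' ?_ (.of_forall fun p => ?_)
    · refine AEStronglyMeasurable.mul ?_ ?_
      · refine Measurable.aestronglyMeasurable (hg.continuous_uncurry_s10.measurable.comp
          (f := fun p : ℝ × ℝ => (p.1 + a p.2, ρ p.2)) (by fun_prop))
      · exact (Complex.continuous_ofReal.comp_aestronglyMeasurable
          hm.aestronglyMeasurable).comp_snd
    · simp only [Function.uncurry, norm_mul, Complex.norm_real]
      exact mul_le_mul_of_nonneg_right (hC _ _) (norm_nonneg _)
  constructor
  · rw [intervalIntegrable_iff_integrableOn_Ioc_of_le two_pi_pos.le]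
    exact hint.integral_prod_left
  · rw [intervalIntegral.integral_of_le two_pi_pos.le, integral_integral_swap hint,
      ← integral_const_mul]
    congr 1
    ext1 v
    rw [integral_mul_const, ← intervalIntegral.integral_of_le two_pi_pos.le, Gs_zero,
      intervalIntegral.integral_comp_add_right (fun s => g s (ρ v))]
    have h2 := (hg.periodic_s10 (ρ v)).intervalIntegral_add_eq (0 + a v) 0
    rw [zero_add] at h2
    rw [zero_add, add_comm (2 * π), h2, zero_add]
    field_simp

lemma one_add_sq_rpow_mul_abs_le (x : ℝ) :
    (1 + x ^ 2) ^ (-(3:ℝ) / 2) * |x| ≤ (1 + x ^ 2)⁻¹ := by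
  have h0 : (0:ℝ) < 1 + x ^ 2 := by positivity
  have h1 : (1 + x ^ 2) ^ (-(3:ℝ) / 2) = (1 + x ^ 2)⁻¹ * (√(1 + x ^ 2))⁻¹ := by
    rw [Real.sqrt_eq_rpow, ← Real.rpow_neg h0.le, ← Real.rpow_neg_one, ← Real.rpow_add h0]
    norm_num
  rw [h1, mul_assoc]
  refine mul_le_of_le_one_right (by positivity) ?_
  rw [inv_mul_le_iff₀ (by positivity), mul_one]
  exact Real.abs_le_sqrt (by linarith)

lemma one_add_sq_rpow_le (x : ℝ) :
    (1 + x ^ 2) ^ (-(3:ℝ) / 2) ≤ (1 + x ^ 2)⁻¹ := by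
  rw [← Real.rpow_neg_one]
  exact Real.rpow_le_rpow_of_exponent_le (by nlinarith) (by norm_num)

lemma ContOnSphere.Hc_zero {g : ℝ → ℝ → ℂ} (hg : ContOnSphere g) (t : ℝ) :
    Hc g 0 t = (2 / π) * ∫ v in Ioi (0:ℝ), Gs g 0 (arctan (√(v ^ 2 + t ^ 2))) *
      (((1 + v ^ 2 + t ^ 2) ^ (-(3:ℝ) / 2) : ℝ) : ℂ) := by
  have hm : IntegrableOn (fun v : ℝ => (1 + v ^ 2 + t ^ 2) ^ (-(3:ℝ) / 2)) (Ioi 0) := by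
    refine integrable_inv_one_add_sq.integrableOn.mono'
      (Measurable.aestronglyMeasurable (by fun_prop)) (.of_forall fun v => ?_)
    rw [Real.norm_of_nonneg (by positivity)]
    refine (Real.rpow_le_rpow_of_nonpos (by positivity) ?_ (by norm_num)).trans
      (one_add_sq_rpow_le v)
    nlinarith
  have h1 := integral_integral_translate hg
    (a := fun v => arccos (-t / √(v ^ 2 + t ^ 2))) (ρ := fun v => arctan (√(v ^ 2 + t ^ 2)))
    (by fun_prop) (by fun_prop) hm
  have h2 := integral_integral_translate hg
    (a := fun v => (-1) * arccos (-t / √(v ^ 2 + t ^ 2)))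
    (ρ := fun v => arctan (√(v ^ 2 + t ^ 2)))
    (by fun_prop) (by fun_prop) hm
  simp only [Hc, RStar, Int.cast_zero, mul_zero, zero_mul, Complex.exp_zero, mul_one]
  rw [intervalIntegral.integral_const_mul, intervalIntegral.integral_add h1.1 h2.1, h1.2, h2.2]
  field_simp
  ring

/-- inversion of `R*` on Fourier coefficients, case `n = 0`. -/
theorem statement10 (g : ℝ → ℝ → ℂ)
    (hg_cont : ContOnSphere g)
    (hg_even : ∀ θ ρ : ℝ, g (θ + π) (π - ρ) = g θ ρ) :
    ∀ᵐ t ∂(volume.restrict (Set.Ioi (0:ℝ))),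
      Gs g 0 (Real.arctan t) =
        -(((1 + t ^ 2) ^ ((3:ℝ) / 2) : ℝ) : ℂ) *
          deriv (fun τ : ℝ => (τ : ℂ) *
            ∫ r in Set.Ioi τ, Hc g 0 r *
              ((1 / (r * Real.sqrt (r ^ 2 - τ ^ 2)) : ℝ) : ℂ)) t := by
  obtain ⟨C, hC⟩ := hg_cont.exists_norm_le_s10
  have hC0 : 0 ≤ C := (norm_nonneg _).trans (hC 0 0)
  set f : ℝ → ℂ := fun x => Gs g 0 (arctan x) * (((1 + x ^ 2) ^ (-(3:ℝ) / 2) : ℝ) : ℂ) with hf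
  have hweight : Continuous fun x : ℝ => (1 + x ^ 2) ^ (-(3:ℝ) / 2) :=
    .rpow_const (by fun_prop) fun x => .inl (by positivity)
  have hfc : Continuous f :=
    (hg_cont.continuous_Gs_zero.comp continuous_arctan).mul
      (Complex.continuous_ofReal.comp hweight)
  have hfn : ∀ x, ‖f x‖ ≤ C * (1 + x ^ 2) ^ (-(3:ℝ) / 2) := fun x => by
    rw [hf]
    simp only [norm_mul, Complex.norm_real]
    rw [Real.norm_of_nonneg (by positivity)]
    exact mul_le_mul_of_nonneg_right (norm_Gs_zero_le hC _) (by positivity)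
  have hfb : ∀ x, ‖f x‖ * |x| ≤ C * (1 + x ^ 2)⁻¹ := fun x =>
    (mul_le_mul_of_nonneg_right (hfn x) (abs_nonneg x)).trans <| by
      rw [mul_assoc]
      exact mul_le_mul_of_nonneg_left (one_add_sq_rpow_mul_abs_le x) hC0
  have hfi : Integrable f :=
    (integrable_inv_one_add_sq.const_mul C).mono' hfc.aestronglyMeasurable <|
      .of_forall fun x => (hfn x).trans (mul_le_mul_of_nonneg_left (one_add_sq_rpow_le x) hC0)
  have hH : ∀ r, Hc g 0 r = (2 / π : ℝ) • ∫ v in Ioi (0:ℝ), f (√(v ^ 2 + r ^ 2)) := fun r => by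
    rw [hg_cont.Hc_zero, Complex.real_smul]
    push_cast
    congr 2
    ext v
    rw [hf]
    simp only
    rw [Real.sq_sqrt (by positivity), add_assoc]
  have key : ∀ τ : ℝ, 0 < τ → (τ : ℂ) * ∫ r in Set.Ioi τ, Hc g 0 r *
      ((1 / (r * Real.sqrt (r ^ 2 - τ ^ 2)) : ℝ) : ℂ) =
        (∫ x in Ioi (0:ℝ), f x) - ∫ x in (0:ℝ)..τ, f x := by
    intro τ hτ
    have h1 : ∫ r in Set.Ioi τ, Hc g 0 r * ((1 / (r * √(r ^ 2 - τ ^ 2)) : ℝ) : ℂ) =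
        (2 / π : ℝ) • ∫ w in Ioi (0:ℝ), (τ ^ 2 + w ^ 2)⁻¹ •
          ∫ v in Ioi (0:ℝ), f (√(v ^ 2 + (τ ^ 2 + w ^ 2))) := by
      rw [integral_Ioi_sqrt_add_sq _ hτ, ← integral_smul]
      refine setIntegral_congr_fun measurableSet_Ioi fun w hw => ?_
      simp only [mem_Ioi] at hw
      have hs : (√(τ ^ 2 + w ^ 2)) ^ 2 = τ ^ 2 + w ^ 2 := Real.sq_sqrt (by positivity)
      have hs0 : 0 < √(τ ^ 2 + w ^ 2) := Real.sqrt_pos.2 (by positivity)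
      simp only [hH, hs]
      rw [add_sub_cancel_left, Real.sqrt_sq hw.le, mul_comm _ (Complex.ofReal _),
        ← Complex.real_smul, smul_smul, smul_smul, smul_smul]
      congr 1
      field_simp
      rw [hs]
    rw [h1, integral_Ioi_integral_Ioi_sqrt hfc hfb hτ, smul_smul, ← Complex.real_smul, smul_smul,
      ← intervalIntegral.integral_Ioi_sub_Ioi hfi.integrableOn hτ.le, _root_.sub_sub_cancel]
    have : τ * (2 / π * (π / (2 * τ))) = 1 := by
      field_simp
    rw [this, one_smul]
  filter_upwards [ae_restrict_mem measurableSet_Ioi] with t ht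
  have hd : HasDerivAt (fun τ : ℝ => (∫ x in Ioi (0:ℝ), f x) - ∫ x in (0:ℝ)..τ, f x) (-f t) t :=
    (hfc.integral_hasStrictDerivAt 0 t).hasDerivAt.const_sub _
  rw [(hd.congr_of_eventuallyEq (eventually_of_mem (Ioi_mem_nhds ht) key)).deriv, neg_mul_neg, hf]
  simp only
  rw [mul_left_comm, ← Complex.ofReal_mul, ← Real.rpow_add (by positivity)]
  norm_num
end

section
/- Let f : ℝ×ℝ → ℂ be continuous, bounded, 2π-periodic in its first variable and even, and suppose there is a 2π-periodic function C : ℝ → ℂ, integrable on [0,2π), such that lim_{t→+∞} f(s,t) = C(s) for almost every s ∈ ℝ. Then for every θ ∈ ℝ, the limit lim_{ρ→(π/2)⁻} Rf(θ,ρ) exists, is finite, and equals (1/π) ∫_{θ+π/2}^{θ+3π/2} C(s) ds. -/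
open MeasureTheory Real Filter Set Topology ENNReal NNReal

/-- For an even function, the integrand of the Radon transform is `π`-periodic. -/
theorem periodic_RT_integrand {f : ℝ → ℝ → ℂ} (heven : ∀ s t : ℝ, f (s + π) (-t) = f s t)
    (θ T : ℝ) : Function.Periodic (fun s => f s (-T * Real.cos (θ - s))) π := by
  intro s
  have h : -T * Real.cos (θ - (s + π)) = -(-T * Real.cos (θ - s)) := by
    rw [← sub_sub, Real.cos_sub_pi]
    ring
  simp only [h, heven]

/-- For an even function, the Radon transform only needs the half circle centred at `θ + π`. -/
theorem RT_eq_integral_half {f : ℝ → ℝ → ℂ} (hcont : Continuous (Function.uncurry f))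
    (heven : ∀ s t : ℝ, f (s + π) (-t) = f s t) (θ ρ : ℝ) :
    RT f θ ρ = (1 / π) *
      ∫ s in (θ + π / 2)..(θ + 3 * π / 2), f s (-Real.tan ρ * Real.cos (θ - s)) := by
  have hg := periodic_RT_integrand heven θ (Real.tan ρ)
  have hc : Continuous fun s => f s (-Real.tan ρ * Real.cos (θ - s)) :=
    hcont.comp (f := fun s => (s, -Real.tan ρ * Real.cos (θ - s))) (by fun_prop)
  have hsplit := intervalIntegral.integral_add_adjacent_intervals
    (hc.intervalIntegrable (μ := volume) 0 π) (hc.intervalIntegrable π (2 * π))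
  have h1 := hg.intervalIntegral_add_eq 0 (θ + π / 2)
  have h2 := hg.intervalIntegral_add_eq π (θ + π / 2)
  rw [show θ + π / 2 + π = θ + 3 * π / 2 by ring] at h1 h2
  rw [zero_add] at h1
  rw [← two_mul] at h2
  have hpi : (π : ℂ) ≠ 0 := Complex.ofReal_ne_zero.mpr Real.pi_ne_zero
  rw [RT, ← hsplit, h1, h2]
  field_simp
  ring

/-- behaviour of `Rf(θ,ρ)` as `ρ → (π/2)⁻` for functions with a periodic
limit `C` at infinity. -/
theorem statement12 (f : ℝ → ℝ → ℂ)
    (hcont : Continuous (Function.uncurry f))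
    (hbdd : ∃ M : ℝ, ∀ s t : ℝ, ‖f s t‖ ≤ M)
    (hper : ∀ s t : ℝ, f (s + 2 * π) t = f s t)
    (heven : ∀ s t : ℝ, f (s + π) (-t) = f s t)
    (C : ℝ → ℂ)
    (hCper : ∀ s : ℝ, C (s + 2 * π) = C s)
    (hCint : IntegrableOn C (Set.Ico (0:ℝ) (2 * π)))
    (hlim : ∀ᵐ s : ℝ, Tendsto (fun t : ℝ => f s t) atTop (𝓝 (C s))) :
    ∀ θ : ℝ, Tendsto (fun ρ : ℝ => RT f θ ρ) (𝓝[<] (π / 2))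
      (𝓝 ((1 / π) * ∫ s in (θ + π / 2)..(θ + 3 * π / 2), C s)) := by
  obtain ⟨M, hM⟩ := hbdd
  intro θ
  simp only [RT_eq_integral_half hcont heven]
  refine Tendsto.const_mul _ ?_
  refine intervalIntegral.tendsto_integral_filter_of_dominated_convergence (fun _ => M)
    (Eventually.of_forall fun ρ => ?_)
    (Eventually.of_forall fun ρ => Eventually.of_forall fun s _ => hM _ _)
    intervalIntegrable_const ?_
  · exact (hcont.comp (f := fun s => (s, -Real.tan ρ * Real.cos (θ - s)))
      (by fun_prop)).aestronglyMeasurable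
  · have hne : ∀ᵐ s : ℝ, s ≠ θ + 3 * π / 2 := by simp [ae_iff]
    filter_upwards [hlim, hne] with s hs hs' hmem
    rw [uIoc_of_le (by linarith [Real.pi_pos])] at hmem
    have hlt : s < θ + 3 * π / 2 := lt_of_le_of_ne hmem.2 hs'
    have hcos : Real.cos (θ - s) < 0 := by
      rw [← Real.cos_neg, neg_sub]
      exact Real.cos_neg_of_pi_div_two_lt_of_lt (by linarith [hmem.1]) (by linarith)
    refine hs.comp ?_
    simp only [neg_mul_comm]
    exact Real.tendsto_tan_pi_div_two.atTop_mul_const (neg_pos.mpr hcos)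
end

section
/- Let f : ℝ×ℝ → ℂ be continuous, bounded, 2π-periodic in its first variable, and vanishing at infinity, i.e. f(s,t) → 0 as |t| → ∞ for every s ∈ ℝ. Then for every θ ∈ ℝ, lim_{ρ→(π/2)⁻} Rf(θ,ρ) = 0. -/
open MeasureTheory Real Filter Set Topology ENNReal NNReal

theorem ae_cos_sub_ne_zero (θ : ℝ) : ∀ᵐ s : ℝ, Real.cos (θ - s) ≠ 0 := by
  have hcount : (Set.range fun k : ℤ => θ - (2 * k + 1) * π / 2).Countable :=
    Set.countable_range _
  filter_upwards [hcount.ae_notMem volume] with s hs hcos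
  obtain ⟨k, hk⟩ := Real.cos_eq_zero_iff.1 hcos
  exact hs ⟨k, by simp only; linarith⟩

/-- for functions vanishing at infinity, `Rf(θ,ρ) → 0` as `ρ → (π/2)⁻`. -/
theorem statement13 (f : ℝ → ℝ → ℂ)
    (hcont : Continuous (Function.uncurry f))
    (hbdd : ∃ M : ℝ, ∀ s t : ℝ, ‖f s t‖ ≤ M)
    (hper : ∀ s t : ℝ, f (s + 2 * π) t = f s t)
    (hvanish : ∀ s : ℝ, Tendsto (fun t : ℝ => f s t) (cocompact ℝ) (𝓝 0)) :
    ∀ θ : ℝ, Tendsto (fun ρ : ℝ => RT f θ ρ) (𝓝[<] (π / 2)) (𝓝 0) := by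
  intro θ
  obtain ⟨M, hM⟩ := hbdd
  suffices hint : Tendsto
      (fun ρ : ℝ => ∫ s in (0:ℝ)..(2 * π), f s (-Real.tan ρ * Real.cos (θ - s)))
      (𝓝[<] (π / 2)) (𝓝 (∫ _ in (0:ℝ)..(2 * π), (0 : ℂ))) by
    simpa [RT] using hint.const_mul ((1 : ℂ) / (2 * π))
  refine intervalIntegral.tendsto_integral_filter_of_dominated_convergence (fun _ => M)
    (Eventually.of_forall fun ρ => ?_)
    (Eventually.of_forall fun ρ => Eventually.of_forall fun s _ => hM _ _)
    intervalIntegrable_const ?_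
  · have hc : Continuous fun s : ℝ => f s (-Real.tan ρ * Real.cos (θ - s)) :=
      hcont.comp (f := fun s : ℝ => (s, -Real.tan ρ * Real.cos (θ - s))) (by fun_prop)
    exact hc.aestronglyMeasurable
  · filter_upwards [ae_cos_sub_ne_zero θ] with s hs _
    refine (hvanish s).comp ?_
    have htan : Tendsto (fun ρ : ℝ => -Real.tan ρ) (𝓝[<] (π / 2)) atBot :=
      tendsto_neg_atTop_atBot.comp Real.tendsto_tan_pi_div_two
    rw [cocompact_eq_atBot_atTop]
    rcases hs.lt_or_gt with h | h
    · exact (htan.atBot_mul_const_of_neg h).mono_right le_sup_right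
    · exact (htan.atBot_mul_const h).mono_right le_sup_left
end

section
/- Let f : ℝ×ℝ → ℂ be continuous, 2π-periodic in its first variable and even. Then for every n ∈ ℤ and every x > 0, G_n(arctan x) = (2·(−1)^{|n|}/π) · ∫₀^{x} F_n(v) · T_{|n|}(v/x) / √(x²−v²) dv. -/
open MeasureTheory Real Filter Set Topology ENNReal NNReal

/-- Fubini's theorem for a continuous integrand over a product of two intervals. -/
lemma intervalIntegral_swap_of_continuous {F : ℝ → ℝ → ℂ} (hF : Continuous (Function.uncurry F))
    (a b c d : ℝ) :
    ∫ x in a..b, ∫ y in c..d, F x y = ∫ y in c..d, ∫ x in a..b, F x y :=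
  intervalIntegral_intervalIntegral_swap <|
    (hF.continuousOn.integrableOn_compact (isCompact_uIcc.prod isCompact_uIcc)).mono_set
      (Set.prod_mono uIoc_subset_uIcc uIoc_subset_uIcc)

lemma exp_neg_I_mul_int_add_pi (n : ℤ) (u : ℝ) :
    Complex.exp (-Complex.I * n * ((u + π : ℝ) : ℂ)) =
      (-1) ^ n.natAbs * Complex.exp (-Complex.I * n * u) := by
  have h : Complex.exp (-Complex.I * n * π) = (-1) ^ n.natAbs := by
    rw [show -Complex.I * n * π = (n : ℂ) * (-(π * Complex.I)) by ring, Complex.exp_int_mul,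
      Complex.exp_neg, Complex.exp_pi_mul_I]
    rcases n with k | k <;> simp [zpow_negSucc, ← inv_pow]
  rw [← h, ← Complex.exp_add]
  push_cast
  ring_nf

lemma neg_one_pow_mul_self (k : ℕ) : ((-1 : ℂ) ^ k) * (-1) ^ k = 1 := by
  rw [← mul_pow]; simp

lemma exp_neg_I_mul_int_add_two_pi (n : ℤ) (u : ℝ) :
    Complex.exp (-Complex.I * n * ((u + 2 * π : ℝ) : ℂ)) = Complex.exp (-Complex.I * n * u) := by
  rw [show u + 2 * π = (u + π) + π by ring, exp_neg_I_mul_int_add_pi, exp_neg_I_mul_int_add_pi,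
    ← mul_assoc, neg_one_pow_mul_self, one_mul]

lemma exp_neg_I_mul_int_add_exp_neg (n : ℤ) (u : ℝ) :
    Complex.exp (-Complex.I * n * u) + Complex.exp (-Complex.I * n * ((-u : ℝ) : ℂ)) =
      2 * ((Real.cos (n * u) : ℝ) : ℂ) := by
  push_cast
  rw [Complex.two_cos]
  ring_nf

lemma continuous_Fc {f : ℝ → ℝ → ℂ} (hf : Continuous (Function.uncurry f)) (n : ℤ) :
    Continuous (Fc f n) := by
  unfold Fc
  refine continuous_const.mul
    (intervalIntegral.continuous_parametric_intervalIntegral_of_continuous' ?_ _ _)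
  have : Continuous fun p : ℝ × ℝ => f p.2 p.1 := hf.comp continuous_swap
  simp only [Function.uncurry_def]
  fun_prop

lemma Fc_neg {f : ℝ → ℝ → ℂ} (hper : ∀ s t : ℝ, f (s + 2 * π) t = f s t)
    (heven : ∀ s t : ℝ, f (s + π) (-t) = f s t) (n : ℤ) (t : ℝ) :
    Fc f n (-t) = (-1) ^ n.natAbs * Fc f n t := by
  have hP : Function.Periodic
      (fun s : ℝ => f s (-t) * Complex.exp (-Complex.I * n * s)) (2 * π) := by
    intro s
    simp only [hper, exp_neg_I_mul_int_add_two_pi]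
  have h1 := hP.intervalIntegral_add_eq 0 (0 + π)
  rw [show 0 + π + 2 * π = (0 + 2 * π) + π by ring,
    ← intervalIntegral.integral_comp_add_right (fun s : ℝ =>
      f s (-t) * Complex.exp (-Complex.I * n * s))] at h1
  simp only [zero_add] at h1
  unfold Fc
  rw [h1]
  simp only [heven, exp_neg_I_mul_int_add_pi]
  simp only [mul_left_comm _ ((-1 : ℂ) ^ n.natAbs)]
  rw [intervalIntegral.integral_const_mul]
  ring

lemma Gc_eq_integral_Fc {f : ℝ → ℝ → ℂ} (hf : Continuous (Function.uncurry f)) (n : ℤ) (ρ : ℝ) :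
    Gc f n ρ = (1 / (2 * π)) * ∫ u in (0 : ℝ)..(2 * π),
      Complex.exp (-Complex.I * n * u) * Fc f n (-Real.tan ρ * Real.cos u) := by
  set y := -Real.tan ρ
  have hcomp : ∀ {g h : ℝ × ℝ → ℝ}, Continuous g → Continuous h →
      Continuous fun p => f (g p) (h p) := fun hg hh => hf.comp (hg.prodMk hh)
  have key : ∫ θ in (0 : ℝ)..(2 * π), ∫ s in (0 : ℝ)..(2 * π),
        f s (y * Real.cos (θ - s)) * Complex.exp (-Complex.I * n * θ) =
      ∫ u in (0 : ℝ)..(2 * π), ∫ s in (0 : ℝ)..(2 * π),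
        f s (y * Real.cos u) * Complex.exp (-Complex.I * n * ((u + s : ℝ) : ℂ)) := by
    refine (intervalIntegral_swap_of_continuous ?_ _ _ _ _).trans
      (Eq.trans ?_ (intervalIntegral_swap_of_continuous ?_ _ _ _ _).symm)
    rotate_left
    · refine intervalIntegral.integral_congr fun s _ => ?_
      have hP : Function.Periodic (fun θ : ℝ =>
          f s (y * Real.cos (θ - s)) * Complex.exp (-Complex.I * n * θ)) (2 * π) := by
        intro θ
        simp only [exp_neg_I_mul_int_add_two_pi]
        rw [show θ + 2 * π - s = (θ - s) + 2 * π by ring, Real.cos_add_two_pi]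
      have h1 := hP.intervalIntegral_add_eq 0 (0 + s)
      rw [show 0 + s + 2 * π = (0 + 2 * π) + s by ring,
        ← intervalIntegral.integral_comp_add_right (fun θ : ℝ =>
          f s (y * Real.cos (θ - s)) * Complex.exp (-Complex.I * n * θ))] at h1
      simpa only [zero_add, add_sub_cancel_right] using h1
    · simp only [Function.uncurry_def]
      exact (hcomp (by fun_prop) (by fun_prop)).mul (by fun_prop)
    · simp only [Function.uncurry_def]
      exact (hcomp (by fun_prop) (by fun_prop)).mul (by fun_prop)
  have hL : ∫ θ in (0 : ℝ)..(2 * π), RT f θ ρ * Complex.exp (-Complex.I * n * θ) =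
      (1 / (2 * π)) * ∫ θ in (0 : ℝ)..(2 * π), ∫ s in (0 : ℝ)..(2 * π),
        f s (y * Real.cos (θ - s)) * Complex.exp (-Complex.I * n * θ) := by
    rw [← intervalIntegral.integral_const_mul]
    refine intervalIntegral.integral_congr fun θ _ => ?_
    simp only [RT, intervalIntegral.integral_mul_const, mul_assoc, y]
  have hR : ∫ u in (0 : ℝ)..(2 * π),
        Complex.exp (-Complex.I * n * u) * Fc f n (y * Real.cos u) =
      (1 / (2 * π)) * ∫ u in (0 : ℝ)..(2 * π), ∫ s in (0 : ℝ)..(2 * π),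
        f s (y * Real.cos u) * Complex.exp (-Complex.I * n * ((u + s : ℝ) : ℂ)) := by
    rw [← intervalIntegral.integral_const_mul]
    refine intervalIntegral.integral_congr fun u _ => ?_
    simp only [Fc]
    rw [mul_left_comm, ← intervalIntegral.integral_const_mul]
    congr 1
    refine intervalIntegral.integral_congr fun s _ => ?_
    rw [mul_left_comm, ← Complex.exp_add]
    push_cast
    ring_nf
  rw [Gc, hL, hR, key]

lemma integral_eq_two_mul_of_periodic {H : ℝ → ℂ} (hH : Continuous H)
    (hP : Function.Periodic H π) :
    ∫ u in (0 : ℝ)..(2 * π), H u = 2 * ∫ u in (0 : ℝ)..(π / 2), (H u + H (-u)) := by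
  have hi : ∀ a b, IntervalIntegrable H volume a b := fun a b => hH.intervalIntegrable a b
  have h1 : ∫ u in π..(2 * π), H u = ∫ u in (0 : ℝ)..π, H u := by
    simpa [two_mul] using hP.intervalIntegral_add_eq π 0
  have h2 : ∫ u in (0 : ℝ)..π, H u = ∫ u in (-(π / 2))..(π / 2), H u := by
    have := hP.intervalIntegral_add_eq 0 (-(π / 2))
    rwa [zero_add, show -(π / 2) + π = π / 2 by ring] at this
  have h3 : ∫ u in (0 : ℝ)..(π / 2), H (-u) = ∫ u in (-(π / 2))..0, H u := by
    simp
  rw [← intervalIntegral.integral_add_adjacent_intervals (hi 0 π) (hi π (2 * π)), h1, h2,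
    intervalIntegral.integral_add (hi _ _)
      (Continuous.intervalIntegrable (u := fun u => H (-u)) (by fun_prop) _ _), h3,
    ← intervalIntegral.integral_add_adjacent_intervals (hi (-(π / 2)) 0) (hi 0 (π / 2))]
  ring

lemma image_mul_cos_Ioo {x : ℝ} (hx : 0 < x) :
    (fun u => x * Real.cos u) '' Ioo 0 (π / 2) = Ioo 0 x := by
  ext v
  constructor
  · rintro ⟨u, ⟨hu0, hu1⟩, rfl⟩
    have hc : 0 < Real.cos u := Real.cos_pos_of_mem_Ioo ⟨by linarith, hu1⟩
    have hc1 : Real.cos u < 1 := by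
      simpa using Real.cos_lt_cos_of_nonneg_of_le_pi_div_two le_rfl hu1.le hu0
    exact ⟨mul_pos hx hc, by nlinarith⟩
  · rintro ⟨hv0, hv1⟩
    refine ⟨Real.arccos (v / x), ⟨Real.arccos_pos.2 ((div_lt_one hx).2 hv1),
      Real.arccos_lt_pi_div_two.2 (div_pos hv0 hx)⟩, ?_⟩
    have h1 : v / x ≤ 1 := (div_le_one hx).2 hv1.le
    have h0 : 0 ≤ v / x := (div_pos hv0 hx).le
    simp only [Real.cos_arccos (by linarith) h1]
    field_simp

lemma integral_chebyshev_T_eq (F : ℝ → ℂ) (m : ℤ) {x : ℝ} (hx : 0 < x) :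
    ∫ v in (0 : ℝ)..x, F v *
        (((Polynomial.Chebyshev.T ℝ m).eval (v / x) / Real.sqrt (x ^ 2 - v ^ 2) : ℝ) : ℂ) =
      ∫ u in (0 : ℝ)..(π / 2), F (x * Real.cos u) * ((Real.cos (m * u) : ℝ) : ℂ) := by
  have hpi := Real.pi_pos
  rw [intervalIntegral.integral_of_le hx.le, intervalIntegral.integral_of_le (by positivity),
    integral_Ioc_eq_integral_Ioo, integral_Ioc_eq_integral_Ioo, ← image_mul_cos_Ioo hx,
    integral_image_eq_integral_abs_deriv_smul (f' := fun u => x * -Real.sin u) measurableSet_Ioo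
      (fun u _ => ((Real.hasDerivAt_cos u).const_mul x).hasDerivWithinAt)]
  · refine setIntegral_congr_fun measurableSet_Ioo fun u hu => ?_
    have hs : 0 < Real.sin u := Real.sin_pos_of_pos_of_lt_pi hu.1 (by linarith [hu.2])
    have hsq : Real.sqrt (x ^ 2 - (x * Real.cos u) ^ 2) = x * Real.sin u := by
      rw [show x ^ 2 - (x * Real.cos u) ^ 2 = (x * Real.sin u) ^ 2 by
        rw [mul_pow, mul_pow, Real.sin_sq]; ring]
      exact Real.sqrt_sq (by positivity)
    have habs : |x * -Real.sin u| = x * Real.sin u := by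
      rw [mul_neg, abs_neg, abs_of_pos (by positivity)]
    simp only [hsq, habs, mul_div_cancel_left₀ _ hx.ne', Polynomial.Chebyshev.T_real_cos]
    rw [Complex.real_smul, mul_left_comm, ← Complex.ofReal_mul]
    congr 2
    field_simp
  · intro u hu v hv huv
    exact Real.injOn_cos ⟨hu.1.le, by linarith [hu.2]⟩ ⟨hv.1.le, by linarith [hv.2]⟩
      (mul_left_cancel₀ hx.ne' huv)

/-- the Fourier coefficients of `Rf` as left-sided Chebyshev fractional
integrals of those of `f`. -/
theorem statement14 (f : ℝ → ℝ → ℂ)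
    (hcont : Continuous (Function.uncurry f))
    (hper : ∀ s t : ℝ, f (s + 2 * π) t = f s t)
    (heven : ∀ s t : ℝ, f (s + π) (-t) = f s t) :
    ∀ n : ℤ, ∀ x : ℝ, 0 < x →
      Gc f n (Real.arctan x) =
        (2 * (-1) ^ n.natAbs / (π : ℂ)) *
          ∫ v in (0:ℝ)..x, Fc f n v *
            (((Polynomial.Chebyshev.T ℝ |n|).eval (v / x) / Real.sqrt (x ^ 2 - v ^ 2) : ℝ) : ℂ) := by
  intro n x hx
  have hcF := continuous_Fc hcont n
  have hneg := Fc_neg hper heven n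
  have hP : Function.Periodic (fun u : ℝ =>
      Complex.exp (-Complex.I * n * u) * Fc f n (-x * Real.cos u)) π := by
    intro u
    simp only [exp_neg_I_mul_int_add_pi, Real.cos_add_pi]
    rw [show -x * -Real.cos u = -(-x * Real.cos u) by ring, hneg, mul_mul_mul_comm,
      neg_one_pow_mul_self, one_mul]
  have hcos : ∀ u : ℝ, Real.cos ((|n| : ℤ) * u) = Real.cos (n * u) := by
    intro u
    rcases abs_choice n with h | h <;> simp [h]
  rw [Gc_eq_integral_Fc hcont, Real.tan_arctan,
    integral_eq_two_mul_of_periodic (by fun_prop) hP, integral_chebyshev_T_eq _ _ hx]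
  have hfold : ∫ u in (0 : ℝ)..(π / 2),
        (Complex.exp (-Complex.I * n * u) * Fc f n (-x * Real.cos u) +
          Complex.exp (-Complex.I * n * ((-u : ℝ) : ℂ)) * Fc f n (-x * Real.cos (-u))) =
      (2 * (-1) ^ n.natAbs) * ∫ u in (0 : ℝ)..(π / 2),
        Fc f n (x * Real.cos u) * ((Real.cos ((|n| : ℤ) * u) : ℝ) : ℂ) := by
    rw [← intervalIntegral.integral_const_mul]
    refine intervalIntegral.integral_congr fun u _ => ?_
    simp only [Real.cos_neg]
    rw [← add_mul, exp_neg_I_mul_int_add_exp_neg, hcos, neg_mul, hneg]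
    ring
  rw [hfold]
  have hpi : (π : ℂ) ≠ 0 := by exact_mod_cast Real.pi_ne_zero
  field_simp
end

section
/- Let f : ℝ×ℝ → ℂ be continuous, 2π-periodic in its first variable and odd, i.e. f(s+π,−t) = −f(s,t) for all s,t. Then Rf(θ,ρ) = 0 for every θ ∈ ℝ and every ρ ∈ [0,π] with ρ ≠ π/2. -/
open MeasureTheory Real Filter Set Topology ENNReal NNReal

theorem Function.Antiperiodic.intervalIntegral_two_mul_eq_zero {E : Type*}
    [NormedAddCommGroup E] [NormedSpace ℝ E] {g : ℝ → E} {c : ℝ}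
    (hg : Function.Antiperiodic g c) : ∫ s in (0:ℝ)..(2 * c), g s = 0 := by
  have hshift : ∫ s in (0:ℝ)..(2 * c), g (s + c) = ∫ s in (0:ℝ)..(2 * c), g s := by
    rw [intervalIntegral.integral_comp_add_right, zero_add, add_comm (2 * c) c]
    simpa using hg.periodic_two_mul.intervalIntegral_add_eq c 0
  simp only [hg _, intervalIntegral.integral_neg] at hshift
  have : IsAddTorsionFree E := .of_isTorsionFree ℝ E
  exact self_eq_neg.mp hshift.symm

/-- `R` annihilates odd functions. -/
theorem statement15 (f : ℝ → ℝ → ℂ)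
    (hcont : Continuous (Function.uncurry f))
    (hper : ∀ s t : ℝ, f (s + 2 * π) t = f s t)
    (hodd : ∀ s t : ℝ, f (s + π) (-t) = -f s t) :
    ∀ θ : ℝ, ∀ ρ ∈ Set.Icc (0:ℝ) π, ρ ≠ π / 2 → RT f θ ρ = 0 := by
  intro θ ρ _ _
  have hanti : Function.Antiperiodic
      (fun s => f s (-Real.tan ρ * Real.cos (θ - s))) π := by
    intro s
    dsimp only
    rw [← hodd, ← sub_sub, Real.cos_sub_pi, mul_neg]
  rw [RT, hanti.intervalIntegral_two_mul_eq_zero, mul_zero]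
end

section
/- Let n ∈ ℤ with |n| ≥ 2, let C > 0, t > 0, and let F : (0,t] → ℂ be measurable with |F(u)| ≤ C·u^{|n|−1} for all 0 < u ≤ t. Then ∫₀^{t} ∫₀^{x} |F(u)| · |T_{|n|}(u/x)| · |T_{|n|}(t/x)| · x / ( √(t²−x²) · √(x²−u²) ) du dx ≤ (2t)^{|n|} · π · C / 2; in particular the double integral is finite. -/
open MeasureTheory Real Set ENNReal

theorem Polynomial.Chebyshev.eval_T_real_le_two_mul_pow (m : ℕ) {y : ℝ} (hy : 1 ≤ y) :
    (Polynomial.Chebyshev.T ℝ m).eval y ≤ (2 * y) ^ m := by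
  induction m with
  | zero => simp
  | succ m ih =>
    rcases m with _ | m
    · simp; linarith
    · have h := one_le_eval_T_real (m : ℤ) hy
      have hT : (T ℝ ((m + 1 + 1 : ℕ) : ℤ)).eval y =
          2 * y * (T ℝ ((m + 1 : ℕ) : ℤ)).eval y - (T ℝ (m : ℤ)).eval y := by
        simp [add_assoc, one_add_one_eq_two]
      rw [hT, pow_succ' (2 * y) (m + 1)]
      nlinarith

/-- The fundamental theorem of calculus for the lower Lebesgue integral of a nonnegative
derivative. -/
theorem setLIntegral_Ioc_ofReal_deriv_of_nonneg {f f' : ℝ → ℝ} {a b : ℝ} (hab : a ≤ b)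
    (hcont : ContinuousOn f (Icc a b)) (hderiv : ∀ x ∈ Ioo a b, HasDerivAt f (f' x) x)
    (hpos : ∀ x ∈ Ioc a b, 0 ≤ f' x) :
    ∫⁻ x in Ioc a b, ENNReal.ofReal (f' x) = ENNReal.ofReal (f b - f a) := by
  have hint : IntegrableOn f' (Ioc a b) :=
    intervalIntegral.integrableOn_deriv_of_nonneg hcont hderiv
      fun x hx => hpos x (Ioo_subset_Ioc_self hx)
  rw [← intervalIntegral.integral_eq_sub_of_hasDerivAt_of_le hab hcont hderiv
    ((intervalIntegrable_iff_integrableOn_Ioc_of_le hab).2 hint),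
    intervalIntegral.integral_of_le hab, ofReal_integral_eq_lintegral_ofReal hint]
  exact (ae_restrict_iff' measurableSet_Ioc).2 (ae_of_all _ hpos)

theorem setLIntegral_ofReal_div_sqrt_sq_sub_sq {x : ℝ} (hx : 0 ≤ x) :
    ∫⁻ u in Ioc 0 x, ENNReal.ofReal (u / √(x ^ 2 - u ^ 2)) = ENNReal.ofReal x := by
  rw [setLIntegral_Ioc_ofReal_deriv_of_nonneg (f := fun u => -√(x ^ 2 - u ^ 2)) hx
    (by fun_prop) _ fun u hu => div_nonneg hu.1.le (sqrt_nonneg _)]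
  · simp [hx]
  · intro u hu
    have hpos : 0 < x ^ 2 - u ^ 2 := by nlinarith [hu.1, hu.2]
    convert! ((((hasDerivAt_id u).pow 2).const_sub (x ^ 2)).sqrt hpos.ne').neg using 1
    have := (sqrt_pos.2 hpos).ne'
    simp
    field_simp

theorem setLIntegral_ofReal_inv_sqrt_sq_sub_sq {t : ℝ} (ht : 0 < t) :
    ∫⁻ x in Ioc 0 t, ENNReal.ofReal (1 / √(t ^ 2 - x ^ 2)) = ENNReal.ofReal (π / 2) := by
  rw [setLIntegral_Ioc_ofReal_deriv_of_nonneg (f := fun x => arcsin (x / t)) ht.le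
    (by fun_prop) _ fun x _ => div_nonneg zero_le_one (sqrt_nonneg _)]
  · simp [ht.ne']
  · intro x hx
    have h1 : x / t < 1 := (div_lt_one ht).2 hx.2
    have h0 : 0 < x / t := div_pos hx.1 ht
    convert! (hasDerivAt_arcsin (by linarith) h1.ne).comp x ((hasDerivAt_id x).div_const t) using 1
    have hs : √(t ^ 2 - x ^ 2) = t * √(1 - (x / t) ^ 2) := by
      rw [← sqrt_sq ht.le, ← sqrt_mul (sq_nonneg _), sqrt_sq ht.le]
      congr 1
      field_simp
    simp only [hs]
    rw [div_mul_div_comm, one_mul, mul_comm]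

theorem chebyshev_kernel_le {k : ℕ} {C t x u f : ℝ} (hC : 0 ≤ C) (hu : 0 < u)
    (hux : u ≤ x) (hxt : x ≤ t) (hf : f ≤ C * u ^ (k + 1)) :
    f * |(Polynomial.Chebyshev.T ℝ ((k + 2 : ℕ) : ℤ)).eval (u / x)| *
        |(Polynomial.Chebyshev.T ℝ ((k + 2 : ℕ) : ℤ)).eval (t / x)| * x /
        (√(t ^ 2 - x ^ 2) * √(x ^ 2 - u ^ 2)) ≤
      C * (2 * t) ^ (k + 2) / (√(t ^ 2 - x ^ 2) * x) * (u / √(x ^ 2 - u ^ 2)) := by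
  have hx : 0 < x := hu.trans_le hux
  have ht : 0 < t := hx.trans_le hxt
  have hf' : f ≤ C * (x ^ k * u) := hf.trans (by rw [pow_succ]; gcongr)
  have h1 : |(Polynomial.Chebyshev.T ℝ ((k + 2 : ℕ) : ℤ)).eval (u / x)| ≤ 1 :=
    Polynomial.Chebyshev.abs_eval_T_real_le_one _ <| by
      rw [abs_of_pos (div_pos hu hx)]
      exact (div_le_one hx).2 hux
  have h2 : |(Polynomial.Chebyshev.T ℝ ((k + 2 : ℕ) : ℤ)).eval (t / x)| ≤
      (2 * (t / x)) ^ (k + 2) := by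
    have htx : 1 ≤ t / x := (one_le_div hx).2 hxt
    rw [abs_of_pos (one_pos.trans_le (Polynomial.Chebyshev.one_le_eval_T_real _ htx))]
    exact Polynomial.Chebyshev.eval_T_real_le_two_mul_pow _ htx
  calc _ ≤ C * (x ^ k * u) * 1 * (2 * (t / x)) ^ (k + 2) * x /
        (√(t ^ 2 - x ^ 2) * √(x ^ 2 - u ^ 2)) := by gcongr
    _ = C * (2 * t) ^ (k + 2) * u / x / (√(t ^ 2 - x ^ 2) * √(x ^ 2 - u ^ 2)) := by
      congr 1
      rw [← mul_div_assoc, div_pow]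
      field_simp
      ring
    _ = _ := by
      simp only [div_eq_mul_inv, mul_inv]
      ring

/-- bound on the double integral appearing in the proof of the inversion
formula, for `|n| ≥ 2`. -/
theorem statement18 (n : ℤ) (hn : 2 ≤ |n|) (C : ℝ) (hC : 0 < C) (t : ℝ) (ht : 0 < t)
    (F : ℝ → ℂ) (hFmeas : AEMeasurable F (volume.restrict (Set.Ioc (0:ℝ) t)))
    (hFbound : ∀ u : ℝ, 0 < u → u ≤ t → ‖F u‖ ≤ C * u ^ (n.natAbs - 1)) :
    (∫⁻ x in Set.Ioc (0:ℝ) t, ∫⁻ u in Set.Ioc (0:ℝ) x,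
        ENNReal.ofReal (‖F u‖ * |(Polynomial.Chebyshev.T ℝ |n|).eval (u / x)| *
          |(Polynomial.Chebyshev.T ℝ |n|).eval (t / x)| * x /
          (Real.sqrt (t ^ 2 - x ^ 2) * Real.sqrt (x ^ 2 - u ^ 2))))
      ≤ ENNReal.ofReal ((2 * t) ^ n.natAbs * π * C / 2) := by
  obtain ⟨k, hk⟩ : ∃ k : ℕ, n.natAbs = k + 2 := ⟨n.natAbs - 2, by rw [Int.abs_eq_natAbs] at hn; omega⟩
  rw [Int.abs_eq_natAbs, hk]
  rw [hk] at hFbound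
  calc _ ≤ ∫⁻ x in Ioc 0 t, ENNReal.ofReal (C * (2 * t) ^ (k + 2)) *
        ENNReal.ofReal (1 / √(t ^ 2 - x ^ 2)) := by
        refine setLIntegral_mono' measurableSet_Ioc fun x hx => ?_
        have hx0 : 0 < x := hx.1
        calc _ ≤ ∫⁻ u in Ioc 0 x,
              ENNReal.ofReal (C * (2 * t) ^ (k + 2) / (√(t ^ 2 - x ^ 2) * x)) *
                ENNReal.ofReal (u / √(x ^ 2 - u ^ 2)) := by
              refine setLIntegral_mono' measurableSet_Ioc fun u hu => ?_
              rw [← ENNReal.ofReal_mul (by positivity)]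
              exact ENNReal.ofReal_le_ofReal <| chebyshev_kernel_le hC.le hu.1 hu.2 hx.2 <|
                hFbound u hu.1 (hu.2.trans hx.2)
          _ = _ := by
              rw [lintegral_const_mul' _ _ ENNReal.ofReal_ne_top,
                setLIntegral_ofReal_div_sqrt_sq_sub_sq hx0.le,
                ← ENNReal.ofReal_mul (by positivity), ← ENNReal.ofReal_mul (by positivity)]
              congr 1
              rw [← div_div, div_mul_cancel₀ _ hx0.ne', mul_one_div]
    _ = ENNReal.ofReal ((2 * t) ^ (k + 2) * π * C / 2) := by
        rw [lintegral_const_mul' _ _ ENNReal.ofReal_ne_top,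
          setLIntegral_ofReal_inv_sqrt_sq_sub_sq ht, ← ENNReal.ofReal_mul (by positivity)]
        congr 1
        ring
end
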